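/- (Logarithmic energy estimate) Let $1 < g_0 \le g_1 < \infty$, and let $g : [0,\infty) \to [0,\infty)$ be continuous and nondecreasing, positive on $(0,\infty)$, with $g_0\,G(\sigma) \le \sigma g(\sigma) \le g_1\,G(\sigma)$ for all $\sigma > 0$, where $G(\sigma) = \int_0^\sigma g(s)\,ds$. Put $h(\sigma) = G(\sigma)/\sigma$ for $\sigma > 0$, $h(0) = 0$, and $H(\sigma) = \int_0^\sigma h(s)\,ds$. Let $N \ge 1$, $C_0, C_1 > 0$, $R > 0$, $t_0 < t_1$, and let $K_R = \{x \in \mathbb{R}^N : \max_i |x_i| < R\}$ and $Q = K_R \times (t_0,t_1)$. A bounded weak solution on $K_R \times [t_0,t_1]$ (of $u_t - \operatorname{div} \mathbf{A}(x,t,u,Du) = 0$ under the structure conditions $\mathbf{A}\cdot Du \ge C_0 G(|Du|)$, $|\mathbf{A}| \le C_1 g(|Du|)$) is a pair $(u,V)$ such that: $u : K_R \times [t_0,t_1] \to \mathbb{R}$ is bounded and continuous; $V : Q \to \mathbb{R}^N$ is measurable with $\iint_Q G(|V|)\,dx\,dt < \infty$ and is the weak spatial gradient of $u$ in $Q$,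 i.e. $\iint_Q u\,\partial_{x_i}\varphi \,dx\,dt= -\iint_Q V_i\,\varphi\,dx\,dt$ for every $\varphi \in C_c^\infty(Q)$ and every $i$; and there is a measurable $a : Q \to \mathbb{R}^N$ with $a\cdot V \ge C_0 G(|V|)$ and $|a| \le C_1 g(|V|)$ a.e. in $Q$ such that, for every Lipschitz function $\varphi$ on $\overline{K_R} \times [t_0,t_1]$ vanishing in a neighborhood of $(\partial K_R \times [t_0,t_1]) \cup (\overline{K_R} \times \{t_0\})$ and all $t_0 \le \tau_1 \le \tau_2 \le t_1$, $$\int_{K_R} u(x,\tau_2)\varphi(x,\tau_2)\,dx - \int_{K_R} u(x,\tau_1)\varphi(x,\tau_1)\,dx = \int_{\tau_1}^{\tau_2}\!\int_{K_R} \left( u\,\partial_t\varphi - a\cdot D\varphi \right) dx\,dt,$$ where $D\varphi$ is the spatial gradient of $\varphi$. Let $(u,V)$ be such a solution with $u \ge 0$, and let $k > 0$, $\delta \in (0,1)$ and $q \ge g_1$. On $K_R \times [t_0,t_1]$ define $$\Psi = \ln^+\!\left[ \frac{k}{(1+\delta)k - (u-k)_-} \right], \qquad \Psi' = \frac{-1}{(1+\delta)k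 - (u-k)_-},$$ where $(u-k)_- = \max(k-u,0)$ and $\ln^+ = \max(\ln,0)$. Then there is a constant $C > 0$ depending only on $C_0$, $C_1$, $g_1$ and $q$ such that, for every Lipschitz cutoff $\zeta : \overline{K_R} \to [0,1]$ (independent of $t$) vanishing in a neighborhood of $\partial K_R$, $$\int_{K_R\times\{t_1\}} H(\Psi^2)\,\zeta^{q}\,dx \le \int_{K_R\times\{t_0\}} H(\Psi^2)\,\zeta^{q}\,dx + C \int_{t_0}^{t_1}\!\int_{K_R} h(\Psi^2)\,|\Psi|\,|\Psi'|^2\, G\!\left(\frac{|D\zeta|}{|\Psi'|}\right) \zeta^{q-g_1}\,dx\,dt,$$ where $D\zeta$ is the spatial gradient of $\zeta$. -/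

import Mathlib

open Set MeasureTheory

noncomputable section

/-- The open cube in `ℝ^N` of center `y` and half side-length `ρ`. -/
def cube (N : ℕ) (y : EuclideanSpace ℝ (Fin N)) (ρ : ℝ) : Set (EuclideanSpace ℝ (Fin N)) :=
  {x | ∀ i, |x i - y i| < ρ}

/-- `G(σ) = ∫_0^σ g(s) ds`. Only arguments `σ ≥ 0` matter. -/
def bigG (g : ℝ → ℝ) (σ : ℝ) : ℝ := ∫ s in (0 : ℝ)..σ, g s

/-- `h(σ) = G(σ)/σ` for `σ > 0` and `h(0) = 0`. Only arguments `σ ≥ 0` matter. -/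
def smallH (g : ℝ → ℝ) (σ : ℝ) : ℝ := if σ = 0 then 0 else bigG g σ / σ

/-- `H(σ) = ∫_0^σ h(s) ds`. Only arguments `σ ≥ 0` matter. -/
def bigH (g : ℝ → ℝ) (σ : ℝ) : ℝ := ∫ s in (0 : ℝ)..σ, smallH g s

/-- The conditions on `g : [0,∞) → [0,∞)`: continuous, nondecreasing, positive on `(0,∞)`, and
`g0·G(σ) ≤ σ·g(σ) ≤ g1·G(σ)` for `σ > 0`. Values of `g` at negative arguments play no role. -/
structure IsStructureFunction (g0 g1 : ℝ) (g : ℝ → ℝ) : Prop where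
  continuousOn : ContinuousOn g (Ici 0)
  monotoneOn : MonotoneOn g (Ici 0)
  nonneg : ∀ σ, 0 ≤ σ → 0 ≤ g σ
  pos : ∀ σ, 0 < σ → 0 < g σ
  lower : ∀ σ, 0 < σ → g0 * bigG g σ ≤ σ * g σ
  upper : ∀ σ, 0 < σ → σ * g σ ≤ g1 * bigG g σ

/-- The parabolic boundary `(∂K × [T0,T1]) ∪ (K̄ × {T0})` of the cylinder `K × (T0,T1)`. -/
def parabolicBoundary {N : ℕ} (K : Set (EuclideanSpace ℝ (Fin N))) (T0 T1 : ℝ) :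
    Set (EuclideanSpace ℝ (Fin N) × ℝ) :=
  frontier K ×ˢ Icc T0 T1 ∪ closure K ×ˢ ({T0} : Set ℝ)

/-- Test functions: Lipschitz on `K̄ × [T0,T1]`, vanishing in a (relative) neighborhood of the
parabolic boundary. -/
structure IsTestFunction {N : ℕ} (K : Set (EuclideanSpace ℝ (Fin N))) (T0 T1 : ℝ)
    (φ : EuclideanSpace ℝ (Fin N) → ℝ → ℝ) : Prop where
  lipschitz : ∃ L, LipschitzOnWith L (fun p : EuclideanSpace ℝ (Fin N) × ℝ => φ p.1 p.2)
    (closure K ×ˢ Icc T0 T1)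
  vanishes : ∃ U : Set (EuclideanSpace ℝ (Fin N) × ℝ), IsOpen U ∧
    parabolicBoundary K T0 T1 ⊆ U ∧ ∀ p ∈ U ∩ closure K ×ˢ Icc T0 T1, φ p.1 p.2 = 0

/-- A bounded weak solution `(u, V)` of `u_t - div A(x,t,u,Du) = 0` on the cylinder
`K × [T0,T1]` under the structure conditions `A·Du ≥ C0·G(|Du|)`, `|A| ≤ C1·g(|Du|)`.
The function `u` is bounded and continuous on `K × [T0,T1]`, both end times included, so that
`u(·,T0)` and `u(·,T1)` are its initial and final values; `V` is its weak spatial gradient, and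
the field `a` plays the role of `A(x,t,u,Du)`. -/
structure IsBoundedWeakSolution {N : ℕ} (C0 C1 : ℝ) (g : ℝ → ℝ)
    (K : Set (EuclideanSpace ℝ (Fin N))) (T0 T1 : ℝ)
    (u : EuclideanSpace ℝ (Fin N) → ℝ → ℝ)
    (V : EuclideanSpace ℝ (Fin N) → ℝ → EuclideanSpace ℝ (Fin N)) : Prop where
  bounded : ∃ M : ℝ, ∀ x ∈ K, ∀ t ∈ Icc T0 T1, |u x t| ≤ M
  continuousOn : ContinuousOn (fun p : EuclideanSpace ℝ (Fin N) × ℝ => u p.1 p.2)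
    (K ×ˢ Icc T0 T1)
  grad_measurable : AEStronglyMeasurable (fun p : EuclideanSpace ℝ (Fin N) × ℝ => V p.1 p.2)
    (volume.restrict (K ×ˢ Ioo T0 T1))
  grad_integrable : IntegrableOn
    (fun p : EuclideanSpace ℝ (Fin N) × ℝ => bigG g ‖V p.1 p.2‖) (K ×ˢ Ioo T0 T1)
  weak_gradient : ∀ φ : EuclideanSpace ℝ (Fin N) × ℝ → ℝ, ContDiff ℝ (⊤ : ℕ∞) φ →
    HasCompactSupport φ → tsupport φ ⊆ K ×ˢ Ioo T0 T1 → ∀ i : Fin N,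
    (∫ p in K ×ˢ Ioo T0 T1, u p.1 p.2 * fderiv ℝ φ p (EuclideanSpace.single i 1, 0)) =
      - ∫ p in K ×ˢ Ioo T0 T1, V p.1 p.2 i * φ p
  weak_form : ∃ a : EuclideanSpace ℝ (Fin N) → ℝ → EuclideanSpace ℝ (Fin N),
    AEStronglyMeasurable (fun p : EuclideanSpace ℝ (Fin N) × ℝ => a p.1 p.2)
      (volume.restrict (K ×ˢ Ioo T0 T1)) ∧
    (∀ᵐ p : EuclideanSpace ℝ (Fin N) × ℝ ∂(volume.restrict (K ×ˢ Ioo T0 T1)),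
      C0 * bigG g ‖V p.1 p.2‖ ≤ inner ℝ (a p.1 p.2) (V p.1 p.2) ∧
      ‖a p.1 p.2‖ ≤ C1 * g ‖V p.1 p.2‖) ∧
    ∀ φ : EuclideanSpace ℝ (Fin N) → ℝ → ℝ, IsTestFunction K T0 T1 φ →
      ∀ τ1 τ2 : ℝ, T0 ≤ τ1 → τ1 ≤ τ2 → τ2 ≤ T1 →
        (∫ x in K, u x τ2 * φ x τ2) - (∫ x in K, u x τ1 * φ x τ1) =
          ∫ t in τ1..τ2, ∫ x in K,
            (u x t * deriv (φ x) t - fderiv ℝ (fun y => φ y t) x (a x t))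

/-- `(1+δ)k − (v−k)_−` with `(v−k)_− = max(k − v, 0)`. -/
def logDenom (k δ v : ℝ) : ℝ := (1 + δ) * k - max (k - v) 0

/-- `Ψ = ln⁺[k / ((1+δ)k − (v−k)_−)]` as a function of the value `v` of the solution. -/
def logPsi (k δ v : ℝ) : ℝ := max (Real.log (k / logDenom k δ v)) 0

/-- `Ψ' = −1 / ((1+δ)k − (v−k)_−)` as a function of the value `v` of the solution. -/
def logPsi' (k δ v : ℝ) : ℝ := -1 / logDenom k δ v

/-- A cutoff function, independent of time: Lipschitz on `K̄` with values in `[0,1]`, vanishing in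
a (relative) neighborhood of `∂K`. -/
structure IsCutoff {N : ℕ} (K : Set (EuclideanSpace ℝ (Fin N)))
    (ζ : EuclideanSpace ℝ (Fin N) → ℝ) : Prop where
  lipschitz : ∃ L, LipschitzOnWith L ζ (closure K)
  mem_Icc : ∀ x ∈ closure K, ζ x ∈ Icc (0 : ℝ) 1
  vanishes : ∃ U : Set (EuclideanSpace ℝ (Fin N)), IsOpen U ∧ frontier K ⊆ U ∧
    ∀ x ∈ U ∩ closure K, ζ x = 0

end

open Filter Topology

namespace IsStructureFunction

variable {g0 g1 : ℝ} {g : ℝ → ℝ}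

lemma intervalIntegrable (hg : IsStructureFunction g0 g1 g) {a b : ℝ} (ha : 0 ≤ a) (hb : 0 ≤ b) :
    IntervalIntegrable g volume a b :=
  (hg.continuousOn.mono fun _ hx => (le_min ha hb).trans hx.1).intervalIntegrable

lemma bigG_zero (g : ℝ → ℝ) : bigG g 0 = 0 := by simp [bigG]

lemma continuousAt (hg : IsStructureFunction g0 g1 g) {σ : ℝ} (hσ : 0 < σ) : ContinuousAt g σ :=
  hg.continuousOn.continuousAt (Ici_mem_nhds hσ)

lemma hasDerivAt_bigG (hg : IsStructureFunction g0 g1 g) {σ : ℝ} (hσ : 0 < σ) :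
    HasDerivAt (bigG g) (g σ) σ := by
  refine intervalIntegral.integral_hasDerivAt_right (hg.intervalIntegrable le_rfl hσ.le) ?_
    (hg.continuousAt hσ)
  exact (hg.continuousOn.mono Ioi_subset_Ici_self).stronglyMeasurableAtFilter isOpen_Ioi σ hσ

lemma bigG_sub (hg : IsStructureFunction g0 g1 g) {a b : ℝ} (ha : 0 ≤ a) (hb : 0 ≤ b) :
    bigG g b - bigG g a = ∫ s in a..b, g s :=
  intervalIntegral.integral_interval_sub_left (hg.intervalIntegrable le_rfl hb)
    (hg.intervalIntegrable le_rfl ha)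

lemma monotoneOn_bigG (hg : IsStructureFunction g0 g1 g) : MonotoneOn (bigG g) (Ici 0) := by
  intro a ha b hb hab
  have h1 := hg.bigG_sub ha hb
  have h2 : 0 ≤ ∫ s in a..b, g s :=
    intervalIntegral.integral_nonneg hab fun s hs => hg.nonneg s (le_trans ha hs.1)
  linarith

lemma bigG_nonneg (hg : IsStructureFunction g0 g1 g) {σ : ℝ} (hσ : 0 ≤ σ) : 0 ≤ bigG g σ := by
  have := hg.monotoneOn_bigG self_mem_Ici hσ hσ
  rwa [bigG_zero] at this

lemma bigG_le_mul (hg : IsStructureFunction g0 g1 g) {σ : ℝ} (hσ : 0 ≤ σ) :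
    bigG g σ ≤ σ * g σ := by
  have h := intervalIntegral.integral_mono_on hσ (hg.intervalIntegrable le_rfl hσ)
    (intervalIntegrable_const (c := g σ)) fun x hx => hg.monotoneOn hx.1 hσ hx.2
  simpa [bigG] using h

lemma continuousOn_bigG (hg : IsStructureFunction g0 g1 g) : ContinuousOn (bigG g) (Ici 0) := by
  intro σ hσ
  rcases eq_or_lt_of_le (show (0 : ℝ) ≤ σ from hσ) with rfl | h
  · have hc : Tendsto (fun σ => σ * g σ) (𝓝[Ici 0] (0 : ℝ)) (𝓝 (0 * g 0)) :=
      (tendsto_id.mono_left nhdsWithin_le_nhds).mul (hg.continuousOn 0 self_mem_Ici)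
    rw [zero_mul] at hc
    rw [ContinuousWithinAt, bigG_zero]
    refine tendsto_of_tendsto_of_tendsto_of_le_of_le' tendsto_const_nhds hc ?_ ?_
    · filter_upwards [self_mem_nhdsWithin] with x hx using hg.bigG_nonneg hx
    · filter_upwards [self_mem_nhdsWithin] with x hx using hg.bigG_le_mul hx
  · exact (hg.hasDerivAt_bigG h).continuousAt.continuousWithinAt

lemma apply_zero (hg : IsStructureFunction g0 g1 g) (h0 : 1 < g0) : g 0 = 0 := by
  by_contra hne
  have hpos : 0 < g 0 := lt_of_le_of_ne (hg.nonneg 0 le_rfl) (Ne.symm hne)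
  have hlow : ∀ σ : ℝ, 0 < σ → g0 * g 0 ≤ g σ := by
    intro σ hσ
    have h := intervalIntegral.integral_mono_on hσ.le (intervalIntegrable_const (c := g 0))
      (hg.intervalIntegrable le_rfl hσ.le) fun x hx => hg.monotoneOn self_mem_Ici hx.1 hx.1
    have h2 : σ * g 0 ≤ bigG g σ := by simpa [bigG] using h
    have h3 := hg.lower σ hσ
    have h4 : σ * (g0 * g 0) ≤ σ * g σ := by nlinarith
    exact le_of_mul_le_mul_left h4 hσ
  have hc : Tendsto g (𝓝[Ioi 0] (0 : ℝ)) (𝓝 (g 0)) :=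
    (hg.continuousOn 0 self_mem_Ici).mono Ioi_subset_Ici_self
  have h5 : g0 * g 0 ≤ g 0 :=
    ge_of_tendsto hc (by filter_upwards [self_mem_nhdsWithin] with x hx using hlow x hx)
  nlinarith

/-- The function `σ ↦ σ ^ (-g1) * G σ` is nonincreasing, which gives `G (c σ) ≤ c ^ g1 * G σ`. -/
lemma bigG_mul_le (hg : IsStructureFunction g0 g1 g) {c σ : ℝ} (hc : 1 ≤ c) (hσ : 0 ≤ σ) :
    bigG g (c * σ) ≤ c ^ g1 * bigG g σ := by
  rcases eq_or_lt_of_le hσ with rfl | hσ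
  · simp [bigG_zero]
  have hd : ∀ s ∈ Ioi (0 : ℝ), HasDerivAt (fun s => s ^ (-g1) * bigG g s)
      ((-g1 * s ^ (-g1 - 1)) * bigG g s + s ^ (-g1) * g s) s := fun s hs =>
    (Real.hasDerivAt_rpow_const (Or.inl (ne_of_gt hs))).mul (hg.hasDerivAt_bigG hs)
  have hanti : AntitoneOn (fun s => s ^ (-g1) * bigG g s) (Ioi (0 : ℝ)) := by
    refine antitoneOn_of_deriv_nonpos (convex_Ioi 0)
      (fun s hs => (hd s hs).continuousAt.continuousWithinAt) ?_ ?_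
    · rw [interior_Ioi]
      exact fun s hs => (hd s hs).differentiableAt.differentiableWithinAt
    · rw [interior_Ioi]
      intro s hs
      have hs' : (0 : ℝ) < s := hs
      rw [(hd s hs).deriv]
      have e : s ^ (-g1) = s ^ (-g1 - 1) * s := by
        rw [← Real.rpow_add_one hs'.ne']; ring_nf
      have hp : 0 < s ^ (-g1 - 1) := Real.rpow_pos_of_pos hs' _
      have hu := hg.upper s hs
      rw [e]
      nlinarith
  have hcσ : 0 < c * σ := by positivity
  have h := hanti (show σ ∈ Ioi (0 : ℝ) from hσ) (show c * σ ∈ Ioi (0 : ℝ) from hcσ)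
    (le_mul_of_one_le_left hσ.le hc)
  have hc0 : 0 < c := by linarith
  simp only at h
  rw [Real.mul_rpow hc0.le hσ.le, Real.rpow_neg hc0.le, Real.rpow_neg hσ.le] at h
  have h1 : 0 < c ^ g1 := Real.rpow_pos_of_pos hc0 _
  have h2 : 0 < σ ^ g1 := Real.rpow_pos_of_pos hσ _
  have h3 : bigG g (c * σ) = c ^ g1 * σ ^ g1 * ((c ^ g1)⁻¹ * (σ ^ g1)⁻¹ * bigG g (c * σ)) := by
    field_simp
  have h4 : c ^ g1 * bigG g σ = c ^ g1 * σ ^ g1 * ((σ ^ g1)⁻¹ * bigG g σ) := by field_simp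
  rw [h3, h4]
  exact mul_le_mul_of_nonneg_left h (by positivity)

lemma mul_apply_le (hg : IsStructureFunction g0 g1 g) {σ : ℝ} (hσ : 0 ≤ σ) :
    σ * g σ ≤ g1 * bigG g σ := by
  rcases eq_or_lt_of_le hσ with rfl | hσ
  · simp [bigG_zero]
  · exact hg.upper σ hσ

/-- Young's inequality with a small parameter. -/
lemma apply_mul_le (hg : IsStructureFunction g0 g1 g) (h1 : 1 < g1) {s b ε : ℝ} (hs : 0 ≤ s)
    (hb : 0 ≤ b) (hε : 0 < ε) (hε1 : ε ≤ 1) :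
    g s * b ≤ ε * g1 * bigG g s + ε * g1 * (ε⁻¹ ^ g1 * bigG g b) := by
  have hGs := hg.bigG_nonneg hs
  have hGb := hg.bigG_nonneg hb
  have hgs := hg.nonneg s hs
  have hpos : 0 ≤ ε⁻¹ ^ g1 := by positivity
  rcases le_total b (ε * s) with h | h
  · have h2 := hg.mul_apply_le hs
    have : g s * b ≤ ε * (s * g s) := by nlinarith
    have h3 : 0 ≤ ε * g1 * (ε⁻¹ ^ g1 * bigG g b) := by positivity
    nlinarith
  · have hsb : s ≤ ε⁻¹ * b := by
      rw [inv_mul_eq_div, le_div_iff₀ hε]; linarith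
    have hb' : 0 ≤ ε⁻¹ * b := by positivity
    have h2 := hg.mul_apply_le hb'
    have h3 := hg.bigG_mul_le (one_le_inv₀ hε |>.2 hε1) hb
    have h4 : g s ≤ g (ε⁻¹ * b) := hg.monotoneOn hs hb' hsb
    have h5 : g s * b ≤ g (ε⁻¹ * b) * b := mul_le_mul_of_nonneg_right h4 hb
    have h6 : g (ε⁻¹ * b) * b = ε * (ε⁻¹ * b * g (ε⁻¹ * b)) := by field_simp
    have h7 : ε * (ε⁻¹ * b * g (ε⁻¹ * b)) ≤ ε * (g1 * (ε⁻¹ ^ g1 * bigG g b)) :=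
      mul_le_mul_of_nonneg_left (h2.trans (mul_le_mul_of_nonneg_left h3 (by linarith))) hε.le
    have h8 : 0 ≤ ε * g1 * bigG g s := by positivity
    nlinarith

lemma apply_mul_le_add (hg : IsStructureFunction g0 g1 g) (h1 : 1 < g1) {s b : ℝ} (hs : 0 ≤ s)
    (hb : 0 ≤ b) : g s * b ≤ g1 * (bigG g s + bigG g b) := by
  have := hg.apply_mul_le h1 hs hb one_pos le_rfl
  simp only [inv_one, Real.one_rpow, one_mul] at this
  linarith

lemma le_one_add_bigG (hg : IsStructureFunction g0 g1 g) {s : ℝ} (hs : 0 ≤ s) :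
    s ≤ 1 + (g 1)⁻¹ * bigG g s := by
  have hg1 := hg.pos 1 one_pos
  rcases le_total s 1 with h | h
  · have := hg.bigG_nonneg hs
    have : 0 ≤ (g 1)⁻¹ * bigG g s := by positivity
    linarith
  · have h1 := hg.bigG_sub zero_le_one hs
    have h2 := intervalIntegral.integral_mono_on h (intervalIntegrable_const (c := g 1))
      (hg.intervalIntegrable zero_le_one hs)
      fun x hx => hg.monotoneOn (mem_Ici.2 zero_le_one) (mem_Ici.2 (zero_le_one.trans hx.1)) hx.1
    have h3 := hg.bigG_nonneg zero_le_one
    simp only [intervalIntegral.integral_const, smul_eq_mul] at h2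
    have h4 : (g 1)⁻¹ * ((s - 1) * g 1) ≤ (g 1)⁻¹ * bigG g s :=
      mul_le_mul_of_nonneg_left (by linarith) (by positivity)
    have h5 : (g 1)⁻¹ * ((s - 1) * g 1) = s - 1 := by field_simp
    linarith

lemma apply_le_add_bigG (hg : IsStructureFunction g0 g1 g) (h1 : 1 < g1) {s : ℝ} (hs : 0 ≤ s) :
    g s ≤ g1 * bigG g 1 + g1 * bigG g s := by
  have := hg.apply_mul_le_add h1 hs zero_le_one
  linarith

/-! ### The functions `h` and `H` -/

lemma smallH_nonneg (hg : IsStructureFunction g0 g1 g) {σ : ℝ} (hσ : 0 ≤ σ) : 0 ≤ smallH g σ := by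
  unfold smallH
  split_ifs
  · exact le_rfl
  · exact div_nonneg (hg.bigG_nonneg hσ) hσ

lemma smallH_le (hg : IsStructureFunction g0 g1 g) {σ : ℝ} (hσ : 0 ≤ σ) : smallH g σ ≤ g σ := by
  unfold smallH
  split_ifs with h
  · exact hg.nonneg σ hσ
  · rw [div_le_iff₀ (lt_of_le_of_ne hσ (Ne.symm h)), mul_comm]
    exact hg.bigG_le_mul hσ

lemma continuousOn_smallH (hg : IsStructureFunction g0 g1 g) (h0 : 1 < g0) :
    ContinuousOn (smallH g) (Ici 0) := by
  intro σ hσ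
  rcases eq_or_lt_of_le (show (0 : ℝ) ≤ σ from hσ) with rfl | h
  · have hc := hg.continuousOn 0 self_mem_Ici
    rw [ContinuousWithinAt, hg.apply_zero h0] at hc
    rw [ContinuousWithinAt, show smallH g 0 = 0 by simp [smallH]]
    refine tendsto_of_tendsto_of_tendsto_of_le_of_le' tendsto_const_nhds hc ?_ ?_
    · filter_upwards [self_mem_nhdsWithin] with x hx using hg.smallH_nonneg hx
    · filter_upwards [self_mem_nhdsWithin] with x hx using hg.smallH_le hx
  · have : ContinuousAt (fun σ => bigG g σ / σ) σ :=
      (hg.hasDerivAt_bigG h).continuousAt.div continuousAt_id h.ne'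
    refine (this.congr ?_).continuousWithinAt
    filter_upwards [lt_mem_nhds h] with x hx
    simp [smallH, hx.ne']

lemma intervalIntegrable_smallH (hg : IsStructureFunction g0 g1 g) (h0 : 1 < g0) {a b : ℝ}
    (ha : 0 ≤ a) (hb : 0 ≤ b) : IntervalIntegrable (smallH g) volume a b :=
  ((hg.continuousOn_smallH h0).mono fun _ hx => (le_min ha hb).trans hx.1).intervalIntegrable

lemma hasDerivAt_bigH (hg : IsStructureFunction g0 g1 g) (h0 : 1 < g0) {σ : ℝ} (hσ : 0 < σ) :
    HasDerivAt (bigH g) (smallH g σ) σ := by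
  have hc := hg.continuousOn_smallH h0
  refine intervalIntegral.integral_hasDerivAt_right (hg.intervalIntegrable_smallH h0 le_rfl hσ.le)
    ?_ (hc.continuousAt (Ici_mem_nhds hσ))
  exact (hc.mono Ioi_subset_Ici_self).stronglyMeasurableAtFilter isOpen_Ioi σ hσ

lemma bigH_nonneg (hg : IsStructureFunction g0 g1 g) {σ : ℝ} (hσ : 0 ≤ σ) : 0 ≤ bigH g σ :=
  intervalIntegral.integral_nonneg hσ fun _ hs => hg.smallH_nonneg hs.1

lemma bigH_le_mul (hg : IsStructureFunction g0 g1 g) (h0 : 1 < g0) {σ : ℝ} (hσ : 0 ≤ σ) :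
    bigH g σ ≤ σ * g σ := by
  have h := intervalIntegral.integral_mono_on hσ (hg.intervalIntegrable_smallH h0 le_rfl hσ)
    (intervalIntegrable_const (c := g σ)) fun x hx =>
      (hg.smallH_le hx.1).trans (hg.monotoneOn hx.1 hσ hx.2)
  simpa [bigH] using h

end IsStructureFunction

noncomputable section

/-- `y ↦ H(y₊²)`. -/
def sqH (g : ℝ → ℝ) (y : ℝ) : ℝ := bigH g (max y 0 ^ 2)

/-- The derivative of `sqH`. -/
def sqHDeriv (g : ℝ → ℝ) (y : ℝ) : ℝ := 2 * smallH g (max y 0 ^ 2) * max y 0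

/-- The second derivative of `sqH`. -/
def sqHDeriv₂ (g : ℝ → ℝ) (y : ℝ) : ℝ := 4 * g (max y 0 ^ 2) - 2 * smallH g (max y 0 ^ 2)

/-- `v ↦ H(Ψ²)` written without the truncation in the denominator. -/
def logEnergy (g : ℝ → ℝ) (k δ v : ℝ) : ℝ := sqH g (Real.log (k / (v + δ * k)))

/-- The derivative of `logEnergy`. -/
def logEnergyDeriv (g : ℝ → ℝ) (k δ v : ℝ) : ℝ :=
  sqHDeriv g (Real.log (k / (v + δ * k))) * -(v + δ * k)⁻¹

/-- The second derivative of `logEnergy`. -/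
def logEnergyDeriv₂ (g : ℝ → ℝ) (k δ v : ℝ) : ℝ :=
  (sqHDeriv₂ g (Real.log (k / (v + δ * k))) + sqHDeriv g (Real.log (k / (v + δ * k)))) *
    (v + δ * k)⁻¹ ^ 2

end

namespace IsStructureFunction

variable {g0 g1 : ℝ} {g : ℝ → ℝ}

lemma continuous_comp_sq_max {f : ℝ → ℝ} (hf : ContinuousOn f (Ici 0)) :
    Continuous fun y : ℝ => f (max y 0 ^ 2) :=
  hf.comp_continuous (by fun_prop) fun _ => mem_Ici.2 (sq_nonneg _)

lemma continuous_sqHDeriv (hg : IsStructureFunction g0 g1 g) (h0 : 1 < g0) :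
    Continuous (sqHDeriv g) :=
  (continuous_const.mul (continuous_comp_sq_max (hg.continuousOn_smallH h0))).mul (by fun_prop)

lemma continuous_sqHDeriv₂ (hg : IsStructureFunction g0 g1 g) (h0 : 1 < g0) :
    Continuous (sqHDeriv₂ g) :=
  (continuous_const.mul (continuous_comp_sq_max hg.continuousOn)).sub
    (continuous_const.mul (continuous_comp_sq_max (hg.continuousOn_smallH h0)))

lemma hasDerivAt_sqH (hg : IsStructureFunction g0 g1 g) (h0 : 1 < g0) (y : ℝ) :
    HasDerivAt (sqH g) (sqHDeriv g y) y := by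
  refine hasDerivAt_of_hasDerivAt_of_ne' (x := 0) (fun y hy => ?_) ?_
    (hg.continuous_sqHDeriv h0).continuousAt y
  · rcases lt_or_gt_of_ne hy with h | h
    · have e : sqHDeriv g y = 0 := by simp [sqHDeriv, max_eq_right h.le]
      rw [e]
      refine (hasDerivAt_const y (bigH g 0)).congr_of_eventuallyEq ?_
      filter_upwards [gt_mem_nhds h] with z hz
      simp [sqH, max_eq_right (le_of_lt hz)]
    · have h1 := HasDerivAt.comp (h := fun x : ℝ => x ^ 2) y
        (hg.hasDerivAt_bigH h0 (pow_pos h 2)) (hasDerivAt_pow 2 y)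
      have e : sqHDeriv g y = smallH g (y ^ 2) * ((2 : ℕ) * y ^ (2 - 1)) := by
        simp [sqHDeriv, max_eq_left h.le]; ring
      rw [e]
      refine h1.congr_of_eventuallyEq ?_
      filter_upwards [lt_mem_nhds h] with z hz
      simp [sqH, max_eq_left (le_of_lt hz)]
  · have hc : Continuous fun y : ℝ => max y 0 ^ 2 * g (max y 0 ^ 2) :=
      (by fun_prop : Continuous fun y : ℝ => max y 0 ^ 2).mul
        (continuous_comp_sq_max hg.continuousOn)
    have hz : sqH g 0 = 0 := by simp [sqH, bigH]
    have ht := hc.tendsto 0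
    simp only [max_self, ne_eq, OfNat.ofNat_ne_zero, not_false_eq_true, zero_pow, zero_mul] at ht
    rw [ContinuousAt, hz]
    exact tendsto_of_tendsto_of_tendsto_of_le_of_le tendsto_const_nhds ht
      (fun y => hg.bigH_nonneg (sq_nonneg _)) (fun y => hg.bigH_le_mul h0 (sq_nonneg _))

lemma hasDerivAt_sqHDeriv (hg : IsStructureFunction g0 g1 g) (h0 : 1 < g0) (y : ℝ) :
    HasDerivAt (sqHDeriv g) (sqHDeriv₂ g y) y := by
  refine hasDerivAt_of_hasDerivAt_of_ne' (x := 0) (fun y hy => ?_)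
    (hg.continuous_sqHDeriv h0).continuousAt (hg.continuous_sqHDeriv₂ h0).continuousAt y
  rcases lt_or_gt_of_ne hy with h | h
  · have e : sqHDeriv₂ g y = 0 := by
      simp [sqHDeriv₂, max_eq_right h.le, hg.apply_zero h0, smallH]
    rw [e]
    refine (hasDerivAt_const y (0 : ℝ)).congr_of_eventuallyEq ?_
    filter_upwards [gt_mem_nhds h] with z hz
    simp [sqHDeriv, max_eq_right (le_of_lt hz)]
  · have h1 := ((HasDerivAt.comp (h := fun x : ℝ => x ^ 2) y (hg.hasDerivAt_bigG (pow_pos h 2))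
      (hasDerivAt_pow 2 y)).div (hasDerivAt_id y) h.ne').const_mul 2
    have e : sqHDeriv₂ g y = 2 * (((g (y ^ 2) * ((2 : ℕ) * y ^ (2 - 1))) * id y -
        (bigG g ∘ fun x => x ^ 2) y * 1) / (id y) ^ 2) := by
      simp [sqHDeriv₂, max_eq_left h.le, smallH, h.ne']
      field_simp
      ring
    rw [e]
    refine h1.congr_of_eventuallyEq ?_
    filter_upwards [lt_mem_nhds h] with z hz
    simp [sqHDeriv, max_eq_left (le_of_lt hz), smallH, hz.ne']
    field_simp

lemma sqHDeriv₂_nonneg (hg : IsStructureFunction g0 g1 g) (y : ℝ) : 0 ≤ sqHDeriv₂ g y := by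
  have h1 := hg.smallH_le (sq_nonneg (max y 0))
  have h2 := hg.smallH_nonneg (sq_nonneg (max y 0))
  unfold sqHDeriv₂
  linarith

lemma hasDerivAt_log_div {k c v : ℝ} (hk : 0 < k) (hv : 0 < v + c) :
    HasDerivAt (fun v => Real.log (k / (v + c))) (-(v + c)⁻¹) v := by
  have h : HasDerivAt (fun v => Real.log k - Real.log (v + c)) (0 - 1 / (v + c)) v :=
    (hasDerivAt_const v _).sub (((hasDerivAt_id v).add_const c).log hv.ne')
  rw [zero_sub, one_div] at h
  refine h.congr_of_eventuallyEq ?_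
  filter_upwards [lt_mem_nhds (show -c < v by linarith)] with w hw
  rw [Real.log_div hk.ne' (by linarith : 0 < w + c).ne']

lemma hasDerivAt_logEnergy (hg : IsStructureFunction g0 g1 g) (h0 : 1 < g0) {k δ v : ℝ}
    (hk : 0 < k) (hv : 0 < v + δ * k) :
    HasDerivAt (logEnergy g k δ) (logEnergyDeriv g k δ v) v :=
  (hg.hasDerivAt_sqH h0 _).comp v (hasDerivAt_log_div hk hv)

lemma hasDerivAt_logEnergyDeriv (hg : IsStructureFunction g0 g1 g) (h0 : 1 < g0) {k δ v : ℝ}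
    (hk : 0 < k) (hv : 0 < v + δ * k) :
    HasDerivAt (logEnergyDeriv g k δ) (logEnergyDeriv₂ g k δ v) v := by
  have h1 := (hg.hasDerivAt_sqHDeriv h0 (Real.log (k / (v + δ * k)))).comp v
    (hasDerivAt_log_div hk hv)
  have h2 : HasDerivAt (fun v : ℝ => -(v + δ * k)⁻¹) (-(-1 / (v + δ * k) ^ 2)) v :=
    (((hasDerivAt_id v).add_const (δ * k)).inv hv.ne').neg
  refine (h1.mul h2).congr_deriv ?_
  simp only [logEnergyDeriv₂, Function.comp_apply]
  field_simp

lemma continuousOn_logEnergyDeriv₂ (hg : IsStructureFunction g0 g1 g) (h0 : 1 < g0) {k δ : ℝ}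
    (hk : 0 < k) (hδ : 0 < δ) : ContinuousOn (logEnergyDeriv₂ g k δ) (Ici 0) := by
  have hpos : ∀ v ∈ Ici (0 : ℝ), 0 < v + δ * k := fun v hv => by
    have : (0 : ℝ) ≤ v := hv
    positivity
  have hlog : ContinuousOn (fun v => Real.log (k / (v + δ * k))) (Ici 0) := fun v hv =>
    (hasDerivAt_log_div hk (hpos v hv)).continuousAt.continuousWithinAt
  refine (((hg.continuous_sqHDeriv₂ h0).comp_continuousOn hlog).add
    ((hg.continuous_sqHDeriv h0).comp_continuousOn hlog)).mul
    ((ContinuousOn.inv₀ (by fun_prop) fun v hv => (hpos v hv).ne').pow 2)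

end IsStructureFunction

lemma logDenom_pos {k δ v : ℝ} (hk : 0 < k) (hδ : 0 < δ) (hv : 0 ≤ v) : 0 < logDenom k δ v := by
  have h : max (k - v) 0 ≤ k := max_le (by linarith) hk.le
  unfold logDenom
  nlinarith [mul_pos hδ hk]

lemma logPsi_eq {k δ v : ℝ} (hk : 0 < k) (hδ : 0 < δ) (hv : 0 ≤ v) :
    logPsi k δ v = max (Real.log (k / (v + δ * k))) 0 := by
  unfold logPsi logDenom
  have hδk := mul_pos hδ hk
  rcases le_total v k with h | h
  · rw [max_eq_left (by linarith : (0 : ℝ) ≤ k - v)]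
    congr 4
    ring
  · rw [max_eq_right (by linarith : k - v ≤ 0), max_eq_right, max_eq_right]
    · exact Real.log_nonpos (by positivity) (div_le_one_of_le₀ (by nlinarith) (by positivity))
    · exact Real.log_nonpos (div_nonneg hk.le (by nlinarith))
        (div_le_one_of_le₀ (by nlinarith) (by nlinarith))

lemma logPsi_nonneg (k δ v : ℝ) : 0 ≤ logPsi k δ v := le_max_right _ _

lemma logDenom_eq_of_logPsi_pos {k δ v : ℝ} (hk : 0 < k) (hδ : 0 < δ) (hv : 0 ≤ v)
    (h : 0 < logPsi k δ v) : logDenom k δ v = v + δ * k := by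
  have hD := logDenom_pos hk hδ hv
  have h1 : 0 < Real.log (k / logDenom k δ v) := by
    unfold logPsi at h
    rcases lt_max_iff.1 h with h | h
    · exact h
    · exact absurd h (lt_irrefl _)
  have h2 : 1 < k / logDenom k δ v := by
    by_contra hcon
    exact absurd (Real.log_nonpos (by positivity) (not_lt.1 hcon)) (not_le.2 h1)
  rw [one_lt_div hD] at h2
  have h3 : v ≤ k := by
    by_contra hcon
    unfold logDenom at h2
    rw [max_eq_right (by linarith)] at h2
    nlinarith [mul_pos hδ hk]
  unfold logDenom
  rw [max_eq_left (by linarith)]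
  ring

lemma logEnergy_eq (g : ℝ → ℝ) {k δ v : ℝ} (hk : 0 < k) (hδ : 0 < δ) (hv : 0 ≤ v) :
    logEnergy g k δ v = bigH g (logPsi k δ v ^ 2) := by
  rw [logPsi_eq hk hδ hv]; rfl

lemma logEnergyDeriv_eq (g : ℝ → ℝ) {k δ v : ℝ} (hk : 0 < k) (hδ : 0 < δ) (hv : 0 ≤ v) :
    logEnergyDeriv g k δ v =
      -(2 * smallH g (logPsi k δ v ^ 2) * logPsi k δ v * |logPsi' k δ v|) := by
  rcases eq_or_lt_of_le (logPsi_nonneg k δ v) with h | h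
  · rw [← h]
    rw [logPsi_eq hk hδ hv] at h
    simp [logEnergyDeriv, sqHDeriv, ← h]
  · have hD := logDenom_eq_of_logPsi_pos hk hδ hv h
    have hpos : 0 < v + δ * k := by positivity
    rw [logPsi', hD, abs_div, abs_of_pos hpos, logPsi_eq hk hδ hv]
    simp [logEnergyDeriv, sqHDeriv]

lemma le_logEnergyDeriv₂ {g0 g1 : ℝ} {g : ℝ → ℝ} (hg : IsStructureFunction g0 g1 g) {k δ v : ℝ}
    (hk : 0 < k) (hδ : 0 < δ) (hv : 0 ≤ v) :
    2 * smallH g (logPsi k δ v ^ 2) * logPsi k δ v * |logPsi' k δ v| ^ 2 ≤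
      logEnergyDeriv₂ g k δ v := by
  have h2 := hg.sqHDeriv₂_nonneg (Real.log (k / (v + δ * k)))
  rcases eq_or_lt_of_le (logPsi_nonneg k δ v) with h | h
  · rw [← h]
    rw [logPsi_eq hk hδ hv] at h
    have h3 : sqHDeriv g (Real.log (k / (v + δ * k))) = 0 := by simp [sqHDeriv, ← h]
    simp only [mul_zero, zero_mul, logEnergyDeriv₂, h3, add_zero]
    positivity
  · have hD := logDenom_eq_of_logPsi_pos hk hδ hv h
    have hpos : 0 < v + δ * k := by positivity
    rw [logPsi', hD, abs_div, abs_of_pos hpos, logPsi_eq hk hδ hv, abs_neg, abs_one, one_div]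
    refine mul_le_mul_of_nonneg_right ?_ (by positivity)
    change sqHDeriv g _ ≤ _
    linarith

/-- Dominated convergence with a convergent sequence of dominating functions. -/
lemma tendsto_integral_of_tendsto_dominating {α : Type*} [MeasurableSpace α] {μ : Measure α}
    {F b : ℕ → α → ℝ} {f B : α → ℝ} (hF : ∀ n, AEStronglyMeasurable (F n) μ)
    (hb : ∀ n, Integrable (b n) μ) (hB : Integrable B μ) (hFb : ∀ n, ∀ᵐ x ∂μ, |F n x| ≤ b n x)
    (hFf : ∀ᵐ x ∂μ, Tendsto (fun n => F n x) atTop (𝓝 (f x)))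
    (hbB : ∀ᵐ x ∂μ, Tendsto (fun n => b n x) atTop (𝓝 (B x)))
    (hint : Tendsto (fun n => ∫ x, b n x ∂μ) atTop (𝓝 (∫ x, B x ∂μ))) :
    Tendsto (fun n => ∫ x, F n x ∂μ) atTop (𝓝 (∫ x, f x ∂μ)) := by
  have hFb' : ∀ᵐ x ∂μ, ∀ n, |F n x| ≤ b n x := ae_all_iff.2 hFb
  have hfB : ∀ᵐ x ∂μ, |f x| ≤ B x := by
    filter_upwards [hFf, hbB, hFb'] with x h1 h2 h3
    exact le_of_tendsto_of_tendsto' h1.abs h2 h3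
  have hmin : Tendsto (fun n => ∫ x, min (b n x) (B x) ∂μ) atTop (𝓝 (∫ x, B x ∂μ)) := by
    refine tendsto_integral_of_dominated_convergence B
      (fun n => ((hb n).inf hB).aestronglyMeasurable) hB (fun n => ?_) ?_
    · filter_upwards [hFb', hfB] with x h1 h2
      rw [Real.norm_eq_abs, abs_of_nonneg (le_min ((abs_nonneg _).trans (h1 n))
        ((abs_nonneg _).trans h2))]
      exact min_le_right _ _
    · filter_upwards [hbB] with x hx
      simpa using hx.min (tendsto_const_nhds (x := B x))
  have hclamp : Tendsto (fun n => ∫ x, max (-B x) (min (F n x) (B x)) ∂μ) atTop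
      (𝓝 (∫ x, f x ∂μ)) := by
    refine tendsto_integral_of_dominated_convergence B
      (fun n => hB.aestronglyMeasurable.neg.sup ((hF n).inf hB.aestronglyMeasurable)) hB
      (fun n => ?_) ?_
    · filter_upwards [hfB] with x h2
      have := (abs_nonneg _).trans h2
      rw [Real.norm_eq_abs, abs_le]
      exact ⟨le_max_left _ _, max_le (by linarith) (min_le_right _ _)⟩
    · filter_upwards [hFf, hfB] with x h1 h2
      have h3 := (tendsto_const_nhds (x := -B x)).max (h1.min (tendsto_const_nhds (x := B x)))
      rwa [min_eq_left (abs_le.1 h2).2, max_eq_right (abs_le.1 h2).1] at h3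
  have hdiff : Tendsto (fun n => ∫ x, (F n x - max (-B x) (min (F n x) (B x))) ∂μ) atTop
      (𝓝 0) := by
    have h0 : Tendsto (fun n => ∫ x, (b n x - min (b n x) (B x)) ∂μ) atTop (𝓝 0) := by
      have : ∀ n, ∫ x, (b n x - min (b n x) (B x)) ∂μ =
          ∫ x, b n x ∂μ - ∫ x, min (b n x) (B x) ∂μ :=
        fun n => integral_sub (hb n) ((hb n).inf hB)
      simp_rw [this]
      simpa using hint.sub hmin
    refine squeeze_zero_norm (fun n => ?_) h0
    refine norm_integral_le_of_norm_le ((hb n).sub ((hb n).inf hB)) ?_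
    filter_upwards [hFb', hfB] with x h1 h2
    have h3 := abs_le.1 (h1 n)
    have h4 := (abs_nonneg _).trans h2
    rw [Real.norm_eq_abs, abs_le]
    constructor <;>
    · rcases le_total (F n x) (B x) with h5 | h5 <;> rcases le_total (b n x) (B x) with h6 | h6 <;>
      rcases le_total (-B x) (F n x) with h7 | h7 <;>
      simp only [h5, h6, h7, min_eq_left, min_eq_right, max_eq_left, max_eq_right] <;>
      first
      | linarith
      | (rw [max_eq_right (by linarith)]; linarith)
  have hsum := hdiff.add hclamp
  rw [zero_add] at hsum
  refine hsum.congr fun n => ?_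
  have hFi : Integrable (F n) μ := (hb n).mono' (hF n) (hFb n)
  have hCi : Integrable (fun x => max (-B x) (min (F n x) (B x))) μ := hB.neg.sup (hFi.inf hB)
  rw [integral_sub hFi hCi]
  ring

section Mollify

open scoped Convolution
open ContinuousLinearMap

variable {P : Type*} [NormedAddCommGroup P] [NormedSpace ℝ P] [FiniteDimensional ℝ P]
  [MeasurableSpace P] [BorelSpace P]

/-- Mollification of `f` by a normalized bump function. -/
noncomputable def mollify (μ : Measure P) (ρ : ContDiffBump (0 : P)) (f : P → ℝ) : P → ℝ :=
  ρ.normed μ ⋆[lsmul ℝ ℝ, μ] f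

variable {μ : Measure P} [μ.IsAddHaarMeasure] {ρ : ContDiffBump (0 : P)} {f : P → ℝ}

lemma mollify_apply (x : P) : mollify μ ρ f x = ∫ y, ρ.normed μ (x - y) * f y ∂μ := by
  simp [mollify, convolution_eq_swap]

lemma contDiff_mollify (hf : LocallyIntegrable f μ) {n : ℕ∞} : ContDiff ℝ n (mollify μ ρ f) :=
  ρ.hasCompactSupport_normed.contDiff_convolution_left _ ρ.contDiff_normed hf

lemma hasCompactSupport_mollify (hf : HasCompactSupport f) : HasCompactSupport (mollify μ ρ f) :=
  ρ.hasCompactSupport_normed.convolution _ hf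

lemma tsupport_mollify_subset :
    tsupport (mollify μ ρ f) ⊆ Metric.cthickening ρ.rOut (tsupport f) := by
  refine closure_minimal (fun x hx => ?_) Metric.isClosed_cthickening
  rw [Function.mem_support, mollify_apply] at hx
  obtain ⟨y, hy⟩ : ∃ y, ρ.normed μ (x - y) * f y ≠ 0 := by
    by_contra! hcon
    simp [hcon] at hx
  have h1 : x - y ∈ Function.support (ρ.normed μ) := left_ne_zero_of_mul hy
  rw [ρ.support_normed_eq, mem_ball_zero_iff] at h1
  exact Metric.mem_cthickening_of_dist_le x y _ _
    (subset_tsupport f (right_ne_zero_of_mul hy)) (by rw [dist_eq_norm]; exact h1.le)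

lemma exists_lipschitzWith_mollify (hf : LocallyIntegrable f μ) (hc : HasCompactSupport f) :
    ∃ C, LipschitzWith C (mollify μ ρ f) :=
  (contDiff_mollify (n := 1) hf).lipschitzWith_of_hasCompactSupport (hasCompactSupport_mollify hc)
    one_ne_zero

lemma integrable_bump_mul (hf : Integrable f μ) (x : P) :
    Integrable (fun y => ρ.normed μ (x - y) * f y) μ := by
  obtain ⟨C, hC⟩ := (ρ.hasCompactSupport_normed (μ := μ)).exists_bound_of_continuous
    ρ.continuous_normed
  exact hf.bdd_mul (c := C)
    (ρ.continuous_normed.comp (continuous_sub_left x)).aestronglyMeasurable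
    (Eventually.of_forall fun y => hC _)

lemma integral_bump_sub (x : P) : ∫ y, ρ.normed μ (x - y) ∂μ = 1 := by
  rw [integral_sub_left_eq_self (fun y => ρ.normed μ y)]
  exact ρ.integral_normed

lemma integrable_bump_sub (x : P) : Integrable (fun y => ρ.normed μ (x - y)) μ :=
  (ρ.integrable_normed (μ := μ)).comp_sub_left x

lemma mollify_nonneg (hf : ∀ y, 0 ≤ f y) (x : P) : 0 ≤ mollify μ ρ f x := by
  rw [mollify_apply]
  exact integral_nonneg fun y => mul_nonneg (ρ.nonneg_normed _) (hf y)

lemma abs_mollify_le (x : P) :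
    |mollify μ ρ f x| ≤ mollify μ ρ (fun y => |f y|) x := by
  rw [mollify_apply, mollify_apply]
  refine (abs_integral_le_integral_abs).trans (le_of_eq ?_)
  congr 1
  ext y
  rw [abs_mul, abs_of_nonneg (ρ.nonneg_normed _)]

lemma mollify_le_of_le {M : ℝ} (hf : Integrable f μ) (h : ∀ y, f y ≤ M) (x : P) :
    mollify μ ρ f x ≤ M := by
  rw [mollify_apply]
  calc ∫ y, ρ.normed μ (x - y) * f y ∂μ ≤ ∫ y, ρ.normed μ (x - y) * M ∂μ :=
        integral_mono (integrable_bump_mul hf x) ((integrable_bump_sub x).mul_const M)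
          fun y => mul_le_mul_of_nonneg_left (h y) (ρ.nonneg_normed _)
    _ = M := by rw [integral_mul_const, integral_bump_sub, one_mul]

lemma integral_bump_mul_add (hf : Integrable f μ) (x : P) (c : ℝ) :
    ∫ y, ρ.normed μ (x - y) * (f y + c) ∂μ = mollify μ ρ f x + c := by
  simp_rw [mul_add]
  rw [integral_add (integrable_bump_mul hf x) ((integrable_bump_sub x).mul_const c),
    integral_mul_const, integral_bump_sub, one_mul, mollify_apply]

/-- A bound on a product of mollifications, from a bound on the tensor product. -/
lemma abs_mollify_mul_mollify_le {f₁ f₂ w : P → ℝ} (h₁ : Integrable f₁ μ) (h₂ : Integrable f₂ μ)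
    (hw : Integrable w μ) (h : ∀ᵐ y ∂μ, ∀ z, |f₁ y| * |f₂ z| ≤ w y + w z) (x : P) :
    |mollify μ ρ f₁ x * mollify μ ρ f₂ x| ≤ 2 * mollify μ ρ w x := by
  set A := mollify μ ρ (fun y => |f₁ y|) x with hA
  have hA0 : 0 ≤ A := mollify_nonneg (fun y => abs_nonneg _) x
  have h3 : ∀ z, A * |f₂ z| ≤ w z + mollify μ ρ w x := by
    intro z
    rw [add_comm, ← integral_bump_mul_add hw, hA, mollify_apply, ← integral_mul_const]
    refine integral_mono_ae ((integrable_bump_mul h₁.abs x).mul_const _) ?_ ?_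
    · simp_rw [mul_add]
      exact (integrable_bump_mul hw x).add ((integrable_bump_sub x).mul_const _)
    · filter_upwards [h] with y hy
      rw [mul_assoc]
      exact mul_le_mul_of_nonneg_left (hy z) (ρ.nonneg_normed _)
  have h4 : A * mollify μ ρ (fun y => |f₂ y|) x ≤ mollify μ ρ w x + mollify μ ρ w x := by
    rw [← integral_bump_mul_add hw, mollify_apply, ← integral_const_mul]
    refine integral_mono ((integrable_bump_mul h₂.abs x).const_mul _) ?_ ?_
    · simp_rw [mul_add]
      exact (integrable_bump_mul hw x).add ((integrable_bump_sub x).mul_const _)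
    · intro z
      have := mul_le_mul_of_nonneg_left (h3 z) (ρ.nonneg_normed (μ := μ) (x - z))
      calc A * (ρ.normed μ (x - z) * |f₂ z|) = ρ.normed μ (x - z) * (A * |f₂ z|) := by ring
        _ ≤ _ := this
  rw [abs_mul, two_mul]
  refine le_trans ?_ h4
  exact mul_le_mul (abs_mollify_le x) (abs_mollify_le x) (abs_nonneg _) hA0

lemma integrable_mollify (hf : Integrable f μ) : Integrable (mollify μ ρ f) μ :=
  (ρ.integrable_normed (μ := μ)).integrable_convolution _ hf

lemma integral_mollify (hf : Integrable f μ) : ∫ x, mollify μ ρ f x ∂μ = ∫ x, f x ∂μ := by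
  rw [mollify, integral_convolution _ ρ.integrable_normed hf, ρ.integral_normed]
  simp

lemma ae_tendsto_mollify {ρ : ℕ → ContDiffBump (0 : P)} (hρ : Tendsto (fun n => (ρ n).rOut) atTop (𝓝 0))
    (hρ' : ∀ n, (ρ n).rOut ≤ 2 * (ρ n).rIn) (hf : LocallyIntegrable f μ) :
    ∀ᵐ x ∂μ, Tendsto (fun n => mollify μ (ρ n) f x) atTop (𝓝 (f x)) :=
  ContDiffBump.ae_convolution_tendsto_right_of_locallyIntegrable hρ (Eventually.of_forall hρ') hf

lemma fderiv_mollify_apply (hf : Integrable f μ) (x e : P) :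
    fderiv ℝ (mollify μ ρ f) x e = ∫ y, fderiv ℝ (ρ.normed μ) (x - y) e * f y ∂μ := by
  have h1 : ContDiff ℝ 1 (ρ.normed μ) := ρ.contDiff_normed (n := 1)
  have h := ρ.hasCompactSupport_normed.hasFDerivAt_convolution_left (lsmul ℝ ℝ) h1
    hf.locallyIntegrable x
  rw [mollify, h.fderiv, convolution_eq_swap]
  obtain ⟨C, hC⟩ := (ρ.hasCompactSupport_normed (μ := μ)).fderiv ℝ |>.exists_bound_of_continuous
    (h1.continuous_fderiv one_ne_zero)
  rw [ContinuousLinearMap.integral_apply]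
  · simp [mul_comm]
  · have hsm : Integrable (fun y => f y • fderiv ℝ (ρ.normed μ) (x - y)) μ :=
      hf.smul_bdd C
        ((h1.continuous_fderiv one_ne_zero).comp (continuous_sub_left x)).aestronglyMeasurable
        (Eventually.of_forall fun y => hC _)
    refine hsm.congr (Eventually.of_forall fun y => ?_)
    ext v
    simp [mul_comm]

/-- Mollification is self-adjoint, hence derivatives of mollifications can be moved. -/
lemma integral_mul_fderiv_mollify {ψ : P → ℝ} (hf : Integrable f μ) (hψ : Integrable ψ μ) (e : P) :
    ∫ x, f x * fderiv ℝ (mollify μ ρ ψ) x e ∂μ = -∫ x, fderiv ℝ (mollify μ ρ f) x e * ψ x ∂μ := by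
  have h1 : ContDiff ℝ 1 (ρ.normed μ) := ρ.contDiff_normed (n := 1)
  have hodd : ∀ z, fderiv ℝ (ρ.normed μ) (-z) e = -fderiv ℝ (ρ.normed μ) z e := by
    intro z
    have h2 : (fun z => ρ.normed μ (-z)) = ρ.normed μ := funext fun z => ρ.normed_neg z
    have h3 : HasFDerivAt (fun z => ρ.normed μ (-z))
        ((fderiv ℝ (ρ.normed μ) (-z)).comp (-ContinuousLinearMap.id ℝ P)) z :=
      ((h1.differentiable one_ne_zero).differentiableAt.hasFDerivAt).comp z (hasFDerivAt_id z).neg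
    rw [h2] at h3
    rw [h3.fderiv]
    simp
  simp_rw [fderiv_mollify_apply hf, fderiv_mollify_apply hψ, ← integral_const_mul,
    ← integral_mul_const, ← integral_neg]
  rw [integral_integral_swap]
  · congr 1
    ext y
    congr 1
    ext x
    rw [← neg_sub y x, hodd]
    ring
  · obtain ⟨C, hC⟩ := (ρ.hasCompactSupport_normed (μ := μ)).fderiv ℝ |>.exists_bound_of_continuous
      (h1.continuous_fderiv one_ne_zero)
    have hc : Continuous fun p : P × P => fderiv ℝ (ρ.normed μ) (p.1 - p.2) e :=
      ((h1.continuous_fderiv one_ne_zero).comp (continuous_fst.sub continuous_snd)).clm_apply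
        continuous_const
    have hb : ∀ p : P × P, ‖fderiv ℝ (ρ.normed μ) (p.1 - p.2) e‖ ≤ C * ‖e‖ := fun p =>
      (le_opNorm _ _).trans (mul_le_mul_of_nonneg_right (hC _) (norm_nonneg _))
    have := (hf.mul_prod hψ).bdd_mul hc.aestronglyMeasurable (Eventually.of_forall hb)
    refine this.congr (Eventually.of_forall fun p => ?_)
    simp only [Function.uncurry]
    ring

end Mollify

section EnergyIdentity

variable {P : Type*} [NormedAddCommGroup P] [NormedSpace ℝ P]

lemma lipschitzWith_mul_of_bounded {α : Type*} [PseudoMetricSpace α] {f g : α → ℝ} {Kf Kg : NNReal}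
    {Bf Bg : ℝ} (hf : LipschitzWith Kf f) (hg : LipschitzWith Kg g) (hBf : ∀ x, |f x| ≤ Bf)
    (hBg : ∀ x, |g x| ≤ Bg) : ∃ K, LipschitzWith K fun x => f x * g x := by
  refine ⟨Real.toNNReal (Bf * Kg + Bg * Kf), LipschitzWith.of_dist_le_mul fun x y => ?_⟩
  have h1 := hf.dist_le_mul x y
  have h2 := hg.dist_le_mul x y
  have hBf0 : 0 ≤ Bf := (abs_nonneg _).trans (hBf x)
  have hBg0 : 0 ≤ Bg := (abs_nonneg _).trans (hBg x)
  rw [Real.coe_toNNReal _ (by positivity)]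
  rw [Real.dist_eq] at h1 h2 ⊢
  calc |f x * g x - f y * g y| = |f x * (g x - g y) + g y * (f x - f y)| := by ring_nf
    _ ≤ |f x| * |g x - g y| + |g y| * |f x - f y| := by
      rw [← abs_mul, ← abs_mul]; exact abs_add_le _ _
    _ ≤ Bf * (Kg * dist x y) + Bg * (Kf * dist x y) := by
      gcongr
      · exact hBf x
      · exact hBg y
    _ = _ := by ring

/-- A composition with a `C¹` function on `[0, ∞)` preserves Lipschitz continuity of bounded
nonnegative functions. -/
lemma exists_lipschitzWith_comp {α : Type*} [PseudoMetricSpace α] {u : α → ℝ} {f f' : ℝ → ℝ}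
    {M : ℝ} {L : NNReal} (hu : LipschitzWith L u) (hu0 : ∀ x, 0 ≤ u x) (huM : ∀ x, u x ≤ M)
    (hf : ∀ v, 0 ≤ v → HasDerivAt f (f' v) v) (hf' : ContinuousOn f' (Ici 0)) :
    ∃ K, LipschitzWith K fun x => f (u x) := by
  obtain ⟨C, hC⟩ := (isCompact_Icc (a := (0 : ℝ)) (b := M)).exists_bound_of_continuousOn
    (hf'.mono Icc_subset_Ici_self)
  have h : LipschitzOnWith C.toNNReal f (Icc 0 M) :=
    (convex_Icc 0 M).lipschitzOnWith_of_nnnorm_hasDerivWithin_le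
      (fun v hv => (hf v hv.1).hasDerivWithinAt) fun v hv => by
        rw [← NNReal.coe_le_coe, coe_nnnorm]
        exact (hC v hv).trans (Real.le_coe_toNNReal C)
  refine ⟨C.toNNReal * L, ?_⟩
  rw [← lipschitzOnWith_univ] at hu ⊢
  exact h.comp hu fun x _ => ⟨hu0 x, huM x⟩

lemma exists_abs_le_of_continuousOn {f : ℝ → ℝ} (hf : ContinuousOn f (Ici 0)) (M : ℝ) :
    ∃ C, 0 ≤ C ∧ ∀ v, 0 ≤ v → v ≤ M → |f v| ≤ C := by
  obtain ⟨C, hC⟩ := (isCompact_Icc (a := (0 : ℝ)) (b := M)).exists_bound_of_continuousOn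
    (hf.mono Icc_subset_Ici_self)
  exact ⟨max C 0, le_max_right _ _, fun v h0 hM => (hC v ⟨h0, hM⟩).trans (le_max_left _ _)⟩

lemma lineDeriv_eq_zero_of_notMem_tsupport {θ : P → ℝ} {x : P} (hx : x ∉ tsupport θ) (v : P) :
    lineDeriv ℝ θ x v = 0 := by
  have h : θ =ᶠ[𝓝 x] fun _ => 0 := by
    filter_upwards [(isClosed_tsupport θ).isOpen_compl.mem_nhds hx] with y hy
    exact image_eq_zero_of_notMem_tsupport hy
  simpa using (((hasFDerivAt_const (0 : ℝ) x).congr_of_eventuallyEq h).hasLineDerivAt v).lineDeriv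

lemma integrable_lineDeriv [MeasurableSpace P] [BorelSpace P] [SecondCountableTopology P]
    {μ : Measure P} [IsFiniteMeasureOnCompacts μ] {θ : P → ℝ} {L : NNReal} (hθ : LipschitzWith L θ)
    (hc : HasCompactSupport θ) (v : P) : Integrable (fun x => lineDeriv ℝ θ x v) μ := by
  have hi : IntegrableOn (fun x => lineDeriv ℝ θ x v) (tsupport θ) μ := by
    refine Measure.integrableOn_of_bounded (M := L * ‖v‖) hc.measure_lt_top.ne
      (aestronglyMeasurable_lineDeriv hθ.continuous μ)
      (Eventually.of_forall fun x => norm_lineDeriv_le_of_lipschitz ℝ hθ)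
  rwa [integrableOn_iff_integrable_of_support_subset] at hi
  intro x hx
  by_contra hcon
  exact hx (lineDeriv_eq_zero_of_notMem_tsupport hcon v)

variable [FiniteDimensional ℝ P] [MeasurableSpace P] [BorelSpace P]
  {μ : Measure P} [μ.IsAddHaarMeasure]

/-- The derivative of a mollification is the mollification of the weak derivative. -/
lemma fderiv_mollify_eq_mollify {Q : Set P} {U W : P → ℝ} {e : P} {ρ : ContDiffBump (0 : P)}
    (hU : Integrable U μ)
    (hgrad : ∀ φ : P → ℝ, ContDiff ℝ (⊤ : ℕ∞) φ → HasCompactSupport φ → tsupport φ ⊆ Q →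
      ∫ p, U p * fderiv ℝ φ p e ∂μ = -∫ p, W p * φ p ∂μ)
    {x : P} (hx : Metric.closedBall x ρ.rOut ⊆ Q) :
    fderiv ℝ (mollify μ ρ U) x e = mollify μ ρ W x := by
  have h1 : ContDiff ℝ (⊤ : ℕ∞) (ρ.normed μ) := ρ.contDiff_normed
  have hφ : ContDiff ℝ (⊤ : ℕ∞) fun y => ρ.normed μ (x - y) := h1.comp (contDiff_const.sub contDiff_id)
  have hsub : tsupport (fun y => ρ.normed μ (x - y)) ⊆ Metric.closedBall x ρ.rOut := by
    refine closure_minimal (fun y hy => ?_) Metric.isClosed_closedBall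
    have h2 : x - y ∈ Function.support (ρ.normed μ) := hy
    rw [ρ.support_normed_eq, mem_ball_zero_iff] at h2
    rw [mem_closedBall_iff_norm, norm_sub_rev]
    exact h2.le
  have hcs : HasCompactSupport fun y => ρ.normed μ (x - y) :=
    (isCompact_closedBall x ρ.rOut).of_isClosed_subset (isClosed_tsupport _) hsub
  have h2 := hgrad _ hφ hcs (hsub.trans hx)
  have h3 : ∀ y, fderiv ℝ (fun y => ρ.normed μ (x - y)) y e = -fderiv ℝ (ρ.normed μ) (x - y) e := by
    intro y
    have h4 : HasFDerivAt (fun y => ρ.normed μ (x - y))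
        ((fderiv ℝ (ρ.normed μ) (x - y)).comp (-ContinuousLinearMap.id ℝ P)) y :=
      ((h1.differentiable (by simp)).differentiableAt.hasFDerivAt).comp y
        ((hasFDerivAt_id y).const_sub x)
    rw [h4.fderiv]
    simp
  rw [fderiv_mollify_apply hU, mollify_apply]
  simp_rw [h3, mul_neg] at h2
  rw [integral_neg, neg_inj] at h2
  simp_rw [mul_comm] at h2 ⊢
  exact h2

/-- The energy identity for mollifications. -/
lemma integral_comp_mollify_mul_lineDeriv {ι : Type*} [Fintype ι] {Q : Set P} {U : P → ℝ}
    {A W : ι → P → ℝ} {e : ι → P} {τ : P} {ρ : ContDiffBump (0 : P)} {M : ℝ} {f f' f'' : ℝ → ℝ}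
    {θ : P → ℝ} {L : NNReal}
    (hU : Integrable U μ) (hUc : HasCompactSupport U) (hU0 : ∀ x, 0 ≤ U x) (hUM : ∀ x, U x ≤ M)
    (hA : ∀ i, Integrable (A i) μ) (hAc : ∀ i, HasCompactSupport (A i))
    (hgrad : ∀ φ : P → ℝ, ContDiff ℝ (⊤ : ℕ∞) φ → HasCompactSupport φ → tsupport φ ⊆ Q → ∀ i,
      ∫ p, U p * fderiv ℝ φ p (e i) ∂μ = -∫ p, W i p * φ p ∂μ)
    (hweak : ∀ φ : P → ℝ, ContDiff ℝ (⊤ : ℕ∞) φ → HasCompactSupport φ → tsupport φ ⊆ Q →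
      ∫ p, U p * fderiv ℝ φ p τ ∂μ = ∑ i, ∫ p, A i p * fderiv ℝ φ p (e i) ∂μ)
    (hf : ∀ v, 0 ≤ v → HasDerivAt f (f' v) v) (hf' : ∀ v, 0 ≤ v → HasDerivAt f' (f'' v) v)
    (hf'' : ContinuousOn f'' (Ici 0))
    (hθ : LipschitzWith L θ) (hθc : HasCompactSupport θ)
    (hρ : Metric.cthickening ρ.rOut (tsupport θ) ⊆ Q) :
    ∫ x, f (mollify μ ρ U x) * lineDeriv ℝ θ x τ ∂μ =
      ∑ i, ∫ x, (f'' (mollify μ ρ U x) * (mollify μ ρ (A i) x * mollify μ ρ (W i) x) * θ x +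
        f' (mollify μ ρ U x) * mollify μ ρ (A i) x * lineDeriv ℝ θ x (e i)) ∂μ := by
  set Uρ := mollify μ ρ U with hUρ
  have hUρ0 : ∀ x, 0 ≤ Uρ x := mollify_nonneg hU0
  have hUρM : ∀ x, Uρ x ≤ M := mollify_le_of_le hU hUM
  have hUρd : ∀ x, HasFDerivAt Uρ (fderiv ℝ Uρ x) x := fun x =>
    ((contDiff_mollify (n := 1) hU.locallyIntegrable).differentiable one_ne_zero x).hasFDerivAt
  obtain ⟨LU, hLU⟩ := exists_lipschitzWith_mollify (ρ := ρ) hU.locallyIntegrable hUc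
  have hf'c : ContinuousOn f' (Ici 0) := fun v hv => (hf' v hv).continuousAt.continuousWithinAt
  obtain ⟨Lf, hLf⟩ := exists_lipschitzWith_comp hLU hUρ0 hUρM hf hf'c
  obtain ⟨Lf', hLf'⟩ := exists_lipschitzWith_comp hLU hUρ0 hUρM hf' hf''
  obtain ⟨C, -, hC⟩ := exists_abs_le_of_continuousOn hf'c M
  obtain ⟨Cθ, hCθ⟩ := hθc.exists_bound_of_continuous hθ.continuous
  obtain ⟨Lψ, hLψ⟩ := lipschitzWith_mul_of_bounded hLf' hθ
    (fun x => hC _ (hUρ0 x) (hUρM x)) hCθ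
  set ψ : P → ℝ := fun x => f' (Uρ x) * θ x with hψ
  have hψc : HasCompactSupport ψ := hθc.mul_left
  have hψi : Integrable ψ μ := hLψ.continuous.integrable_of_hasCompactSupport hψc
  have hψs : tsupport (mollify μ ρ ψ) ⊆ Q :=
    tsupport_mollify_subset.trans
      ((Metric.cthickening_subset_of_subset _ (tsupport_mul_subset_right)).trans hρ)
  have hw := hweak _ (contDiff_mollify hψi.locallyIntegrable) (hasCompactSupport_mollify hψc) hψs
  rw [integral_mul_fderiv_mollify hU hψi, Finset.sum_congr rfl
    (fun i _ => integral_mul_fderiv_mollify (hA i) hψi (e i)), Finset.sum_neg_distrib,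
    neg_inj] at hw
  have htime : ∫ x, fderiv ℝ Uρ x τ * ψ x ∂μ = -∫ x, f (Uρ x) * lineDeriv ℝ θ x τ ∂μ := by
    have h1 := hLf.integral_lineDeriv_mul_eq (μ := μ) hθ hθc τ
    simp_rw [lineDeriv_neg, neg_mul, integral_neg] at h1
    simp_rw [mul_comm (f _)]
    rw [← h1]
    congr 1
    ext x
    have h2 := ((hf (Uρ x) (hUρ0 x)).comp_hasFDerivAt x (hUρd x)).hasLineDerivAt τ
    have h3 : lineDeriv ℝ (fun x => f (Uρ x)) x τ = f' (Uρ x) * fderiv ℝ Uρ x τ := h2.lineDeriv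
    rw [h3, hψ]
    ring
  have hspace : ∀ i, ∫ x, fderiv ℝ (mollify μ ρ (A i)) x (e i) * ψ x ∂μ =
      -∫ x, (f'' (Uρ x) * (mollify μ ρ (A i) x * mollify μ ρ (W i) x) * θ x +
        f' (Uρ x) * mollify μ ρ (A i) x * lineDeriv ℝ θ x (e i)) ∂μ := by
    intro i
    obtain ⟨LA, hLA⟩ := exists_lipschitzWith_mollify (ρ := ρ) (hA i).locallyIntegrable (hAc i)
    have h1 := hLA.integral_lineDeriv_mul_eq (μ := μ) hLψ hψc (e i)
    simp_rw [lineDeriv_neg, neg_mul, integral_neg] at h1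
    have h2 : ∀ x, lineDeriv ℝ (mollify μ ρ (A i)) x (e i) =
        fderiv ℝ (mollify μ ρ (A i)) x (e i) := fun x =>
      ((contDiff_mollify (n := 1) (hA i).locallyIntegrable).differentiable one_ne_zero
        x).lineDeriv_eq_fderiv
    simp_rw [h2] at h1
    rw [h1, neg_inj]
    refine integral_congr_ae ?_
    filter_upwards [hθ.ae_lineDifferentiableAt (μ := μ) (e i)] with x hx
    have h3 : HasLineDerivAt ℝ (fun x => f' (Uρ x)) (f'' (Uρ x) * fderiv ℝ Uρ x (e i)) x (e i) :=
      ((hf' (Uρ x) (hUρ0 x)).comp_hasFDerivAt x (hUρd x)).hasLineDerivAt (e i)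
    have h4 : HasLineDerivAt ℝ ψ (f'' (Uρ x) * fderiv ℝ Uρ x (e i) * θ x +
        f' (Uρ x) * lineDeriv ℝ θ x (e i)) x (e i) := by
      have := HasDerivAt.mul h3 hx.hasLineDerivAt
      simp only [zero_smul, add_zero] at this
      exact this
    rw [h4.lineDeriv]
    by_cases hθx : θ x = 0
    · rw [hθx]; ring
    · have h5 : fderiv ℝ Uρ x (e i) = mollify μ ρ (W i) x := by
        refine fderiv_mollify_eq_mollify hU (fun φ h1 h2 h3 => hgrad φ h1 h2 h3 i) ?_
        exact (Metric.closedBall_subset_cthickening (subset_tsupport θ hθx) _).trans hρ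
      rw [h5]; ring
  rw [htime] at hw
  simp_rw [hspace] at hw
  rw [Finset.sum_neg_distrib, neg_inj] at hw
  exact hw

end EnergyIdentity

section EnergyIdentityLimit

variable {P : Type*} [NormedAddCommGroup P] [NormedSpace ℝ P] [MeasurableSpace P] [BorelSpace P]
  {μ : Measure P}

lemma aestronglyMeasurable_comp_nonneg {α : Type*} [MeasurableSpace α] {ν : Measure α} {f : ℝ → ℝ}
    {U : α → ℝ} (hf : ContinuousOn f (Ici 0)) (hU : AEStronglyMeasurable U ν)
    (hU0 : ∀ x, 0 ≤ U x) : AEStronglyMeasurable (fun x => f (U x)) ν := by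
  have hc : Continuous fun v : ℝ => f (max v 0) :=
    hf.comp_continuous (by fun_prop) fun v => le_max_right v 0
  refine (hc.comp_aestronglyMeasurable hU).congr (Eventually.of_forall fun x => ?_)
  simp [max_eq_left (hU0 x)]

lemma integrable_comp_mul_lineDeriv [SecondCountableTopology P] {U A θ : P → ℝ} {M : ℝ}
    {L : NNReal} {f : ℝ → ℝ}
    (hU : Integrable U μ) (hU0 : ∀ x, 0 ≤ U x) (hUM : ∀ x, U x ≤ M) (hA : Integrable A μ)
    (hf : ContinuousOn f (Ici 0)) (hθ : LipschitzWith L θ) (v : P) :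
    Integrable (fun x => f (U x) * A x * lineDeriv ℝ θ x v) μ := by
  obtain ⟨C, hC0, hC⟩ := exists_abs_le_of_continuousOn hf M
  refine (hA.bdd_mul (c := C) (aestronglyMeasurable_comp_nonneg hf hU.aestronglyMeasurable hU0)
    (Eventually.of_forall fun x => hC _ (hU0 x) (hUM x))).mul_bdd (c := L * ‖v‖)
    (aestronglyMeasurable_lineDeriv hθ.continuous μ)
    (Eventually.of_forall fun x => norm_lineDeriv_le_of_lipschitz ℝ hθ)

lemma integrable_comp_mul_mul {α : Type*} [MeasurableSpace α] {μ : Measure α} {U A W w θ : α → ℝ} {M Cθ : ℝ} {f : ℝ → ℝ}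
    (hU : Integrable U μ) (hU0 : ∀ x, 0 ≤ U x) (hUM : ∀ x, U x ≤ M) (hA : Integrable A μ)
    (hW : Integrable W μ) (hw : Integrable w μ)
    (hAW : ∀ᵐ y ∂μ, |A y * W y| ≤ w y)
    (hf : ContinuousOn f (Ici 0)) (hθ : AEStronglyMeasurable θ μ) (hθb : ∀ x, |θ x| ≤ Cθ) :
    Integrable (fun x => f (U x) * (A x * W x) * θ x) μ := by
  obtain ⟨C, hC0, hC⟩ := exists_abs_le_of_continuousOn hf M
  have hi : Integrable (fun x => A x * W x) μ :=
    hw.mono' (hA.aestronglyMeasurable.mul hW.aestronglyMeasurable) hAW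
  exact (hi.bdd_mul (c := C) (aestronglyMeasurable_comp_nonneg hf hU.aestronglyMeasurable hU0)
    (Eventually.of_forall fun x => hC _ (hU0 x) (hUM x))).mul_bdd (c := Cθ) hθ
    (Eventually.of_forall hθb)

variable [FiniteDimensional ℝ P] [μ.IsAddHaarMeasure]

lemma exists_bump_seq (P : Type*) [NormedAddCommGroup P] : ∃ ρ : ℕ → ContDiffBump (0 : P),
    Tendsto (fun n => (ρ n).rOut) atTop (𝓝 0) ∧ ∀ n, (ρ n).rOut ≤ 2 * (ρ n).rIn := by
  refine ⟨fun n => ⟨1 / ((n : ℝ) + 1), 2 * (1 / ((n : ℝ) + 1)), by positivity, ?_⟩, ?_,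
    fun n => le_rfl⟩
  · have : (0 : ℝ) < 1 / ((n : ℝ) + 1) := by positivity
    linarith
  · simpa using (tendsto_one_div_add_atTop_nhds_zero_nat (𝕜 := ℝ)).const_mul 2

/-- The energy identity for a bounded nonnegative function `U` with weak derivatives `W i` in the
directions `e i`, satisfying `∂_τ U = ∑ ∂_{e i} (A i)` in the sense of distributions on `Q`. -/
lemma integral_comp_mul_lineDeriv {ι : Type*} [Fintype ι] {Q : Set P} {U w : P → ℝ}
    {A W : ι → P → ℝ} {e : ι → P} {τ : P} {M : ℝ} {f f' f'' : ℝ → ℝ} {θ : P → ℝ} {L : NNReal}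
    (hQ : IsOpen Q)
    (hU : Integrable U μ) (hUc : HasCompactSupport U) (hU0 : ∀ x, 0 ≤ U x) (hUM : ∀ x, U x ≤ M)
    (hA : ∀ i, Integrable (A i) μ) (hAc : ∀ i, HasCompactSupport (A i))
    (hW : ∀ i, Integrable (W i) μ) (hw : Integrable w μ)
    (hAW : ∀ i, ∀ᵐ y ∂μ, ∀ z, |A i y| * |W i z| ≤ w y + w z)
    (hgrad : ∀ φ : P → ℝ, ContDiff ℝ (⊤ : ℕ∞) φ → HasCompactSupport φ → tsupport φ ⊆ Q → ∀ i,
      ∫ p, U p * fderiv ℝ φ p (e i) ∂μ = -∫ p, W i p * φ p ∂μ)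
    (hweak : ∀ φ : P → ℝ, ContDiff ℝ (⊤ : ℕ∞) φ → HasCompactSupport φ → tsupport φ ⊆ Q →
      ∫ p, U p * fderiv ℝ φ p τ ∂μ = ∑ i, ∫ p, A i p * fderiv ℝ φ p (e i) ∂μ)
    (hf : ∀ v, 0 ≤ v → HasDerivAt f (f' v) v) (hf' : ∀ v, 0 ≤ v → HasDerivAt f' (f'' v) v)
    (hf'' : ContinuousOn f'' (Ici 0))
    (hθ : LipschitzWith L θ) (hθc : HasCompactSupport θ) (hθQ : tsupport θ ⊆ Q) :
    ∫ x, f (U x) * lineDeriv ℝ θ x τ ∂μ =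
      ∑ i, ∫ x, (f'' (U x) * (A i x * W i x) * θ x + f' (U x) * A i x * lineDeriv ℝ θ x (e i)) ∂μ := by
  obtain ⟨ρ, hρ, hρ2⟩ := exists_bump_seq P
  have hfc : ContinuousOn f (Ici 0) := fun v hv => (hf v hv).continuousAt.continuousWithinAt
  have hf'c : ContinuousOn f' (Ici 0) := fun v hv => (hf' v hv).continuousAt.continuousWithinAt
  obtain ⟨C, hC0, hC⟩ := exists_abs_le_of_continuousOn hfc M
  obtain ⟨C', hC'0, hC'⟩ := exists_abs_le_of_continuousOn hf'c M
  obtain ⟨C'', hC''0, hC''⟩ := exists_abs_le_of_continuousOn hf'' M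
  obtain ⟨Cθ, hCθ⟩ := hθc.exists_bound_of_continuous hθ.continuous
  have hCθ0 : 0 ≤ Cθ := (norm_nonneg _).trans (hCθ 0)
  have hU0n : ∀ n x, 0 ≤ mollify μ (ρ n) U x := fun n => mollify_nonneg hU0
  have hUMn : ∀ n x, mollify μ (ρ n) U x ≤ M := fun n => mollify_le_of_le hU hUM
  have hUm : ∀ n, AEStronglyMeasurable (mollify μ (ρ n) U) μ := fun n =>
    (integrable_mollify hU).aestronglyMeasurable
  have hUt := ae_tendsto_mollify hρ hρ2 hU.locallyIntegrable
  have hAt := fun i => ae_tendsto_mollify hρ hρ2 (hA i).locallyIntegrable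
  have hWt := fun i => ae_tendsto_mollify hρ hρ2 (hW i).locallyIntegrable
  have hcomp : ∀ {F : ℝ → ℝ}, ContinuousOn F (Ici 0) → ∀ x,
      Tendsto (fun n => mollify μ (ρ n) U x) atTop (𝓝 (U x)) →
      Tendsto (fun n => F (mollify μ (ρ n) U x)) atTop (𝓝 (F (U x))) := by
    intro F hF x hx
    exact (hF (U x) (hU0 x)).tendsto.comp
      (tendsto_nhdsWithin_iff.2 ⟨hx, Eventually.of_forall fun n => hU0n n x⟩)
  have hleft : Tendsto (fun n => ∫ x, f (mollify μ (ρ n) U x) * lineDeriv ℝ θ x τ ∂μ) atTop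
      (𝓝 (∫ x, f (U x) * lineDeriv ℝ θ x τ ∂μ)) := by
    refine tendsto_integral_of_dominated_convergence (fun x => C * |lineDeriv ℝ θ x τ|)
      (fun n => (aestronglyMeasurable_comp_nonneg hfc (hUm n) (hU0n n)).mul
        (aestronglyMeasurable_lineDeriv hθ.continuous μ))
      ((integrable_lineDeriv hθ hθc τ).abs.const_mul C) (fun n => Eventually.of_forall fun x => ?_) ?_
    · rw [Real.norm_eq_abs, abs_mul]
      exact mul_le_mul_of_nonneg_right (hC _ (hU0n n x) (hUMn n x)) (abs_nonneg _)
    · filter_upwards [hUt] with x hx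
      exact (hcomp hfc x hx).mul_const _
  have hmain : ∀ i, Tendsto (fun n => ∫ x, f'' (mollify μ (ρ n) U x) *
      (mollify μ (ρ n) (A i) x * mollify μ (ρ n) (W i) x) * θ x ∂μ) atTop
      (𝓝 (∫ x, f'' (U x) * (A i x * W i x) * θ x ∂μ)) := by
    intro i
    refine tendsto_integral_of_tendsto_dominating
      (b := fun n x => C'' * (2 * mollify μ (ρ n) w x) * Cθ) (B := fun x => C'' * (2 * w x) * Cθ)
      (fun n => ?_) (fun n => ?_) ?_ (fun n => Eventually.of_forall fun x => ?_) ?_ ?_ ?_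
    · exact ((aestronglyMeasurable_comp_nonneg hf'' (hUm n) (hU0n n)).mul
        ((integrable_mollify (hA i)).aestronglyMeasurable.mul
        (integrable_mollify (hW i)).aestronglyMeasurable)).mul hθ.continuous.aestronglyMeasurable
    · exact (((integrable_mollify hw).const_mul 2).const_mul C'').mul_const Cθ
    · exact ((hw.const_mul 2).const_mul C'').mul_const Cθ
    · rw [abs_mul, abs_mul]
      have h1 := hC'' _ (hU0n n x) (hUMn n x)
      have h2 := abs_mollify_mul_mollify_le (ρ := ρ n) (hA i) (hW i) hw (hAW i) x
      have h3 : |θ x| ≤ Cθ := hCθ x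
      gcongr
      · exact mul_nonneg hC''0 ((abs_nonneg _).trans h2)
    · filter_upwards [hUt, hAt i, hWt i] with x h1 h2 h3
      exact ((hcomp hf'' x h1).mul (h2.mul h3)).mul_const _
    · filter_upwards [ae_tendsto_mollify hρ hρ2 hw.locallyIntegrable] with x hx
      exact ((hx.const_mul 2).const_mul C'').mul_const Cθ
    · simp_rw [integral_mul_const, integral_const_mul, integral_mollify hw]
      exact tendsto_const_nhds
  have hflux : ∀ i, Tendsto (fun n => ∫ x, f' (mollify μ (ρ n) U x) * mollify μ (ρ n) (A i) x *
      lineDeriv ℝ θ x (e i) ∂μ) atTop (𝓝 (∫ x, f' (U x) * A i x * lineDeriv ℝ θ x (e i) ∂μ)) := by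
    intro i
    refine tendsto_integral_of_tendsto_dominating
      (b := fun n x => C' * mollify μ (ρ n) (fun y => |A i y|) x * ((L : ℝ) * ‖e i‖))
      (B := fun x => C' * |A i x| * ((L : ℝ) * ‖e i‖))
      (fun n => ?_) (fun n => ?_) ?_ (fun n => Eventually.of_forall fun x => ?_) ?_ ?_ ?_
    · exact ((aestronglyMeasurable_comp_nonneg hf'c (hUm n) (hU0n n)).mul
        (integrable_mollify (hA i)).aestronglyMeasurable).mul
        (aestronglyMeasurable_lineDeriv hθ.continuous μ)
    · exact ((integrable_mollify (hA i).abs).const_mul C').mul_const _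
    · exact ((hA i).abs.const_mul C').mul_const _
    · rw [abs_mul, abs_mul]
      have h1 := hC' _ (hU0n n x) (hUMn n x)
      have h2 := abs_mollify_le (μ := μ) (ρ := ρ n) (f := A i) x
      have h3 : |lineDeriv ℝ θ x (e i)| ≤ L * ‖e i‖ := norm_lineDeriv_le_of_lipschitz ℝ hθ
      gcongr
      · exact mul_nonneg hC'0 ((abs_nonneg _).trans h2)
    · filter_upwards [hUt, hAt i] with x h1 h2
      exact ((hcomp hf'c x h1).mul h2).mul_const _
    · filter_upwards [ae_tendsto_mollify hρ hρ2 (hA i).abs.locallyIntegrable] with x hx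
      exact (hx.const_mul C').mul_const _
    · simp_rw [integral_mul_const, integral_const_mul]
      simp_rw [fun n => integral_mollify (ρ := ρ n) (hA i).abs]
      exact tendsto_const_nhds
  refine tendsto_nhds_unique hleft ?_
  have hright := tendsto_finsetSum Finset.univ fun i _ => (hmain i).add (hflux i)
  have hsplit : ∀ i, ∫ x, (f'' (U x) * (A i x * W i x) * θ x +
      f' (U x) * A i x * lineDeriv ℝ θ x (e i)) ∂μ = ∫ x, f'' (U x) * (A i x * W i x) * θ x ∂μ +
      ∫ x, f' (U x) * A i x * lineDeriv ℝ θ x (e i) ∂μ := fun i =>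
    integral_add (integrable_comp_mul_mul hU hU0 hUM (hA i) (hW i) (hw.add hw)
      ((hAW i).mono fun y hy => by rw [abs_mul]; exact hy y) hf''
      hθ.continuous.aestronglyMeasurable hCθ)
      (integrable_comp_mul_lineDeriv hU hU0 hUM (hA i) hf'c hθ _)
  simp_rw [hsplit]
  refine hright.congr' ?_
  obtain ⟨d, hd, hdQ⟩ := hθc.isCompact.exists_cthickening_subset_open hQ hθQ
  filter_upwards [hρ.eventually (gt_mem_nhds hd)] with n hn
  rw [integral_comp_mollify_mul_lineDeriv hU hUc hU0 hUM hA hAc hgrad hweak hf hf' hf'' hθ hθc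
    ((Metric.cthickening_mono hn.le _).trans hdQ)]
  refine Finset.sum_congr rfl fun i _ => (integral_add ?_ ?_).symm
  · exact integrable_comp_mul_mul (integrable_mollify hU) (hU0n n) (hUMn n)
      (integrable_mollify (hA i)) (integrable_mollify (hW i))
      ((integrable_mollify hw).const_mul 2) (Eventually.of_forall fun x =>
        abs_mollify_mul_mollify_le (hA i) (hW i) hw (hAW i) x) hf''
      hθ.continuous.aestronglyMeasurable hCθ
  · exact integrable_comp_mul_lineDeriv (integrable_mollify hU) (hU0n n) (hUMn n)
      (integrable_mollify (hA i)) hf'c hθ _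

end EnergyIdentityLimit

section Cylinder

lemma isOpen_cube (N : ℕ) (y : EuclideanSpace ℝ (Fin N)) (ρ : ℝ) : IsOpen (cube N y ρ) := by
  have : cube N y ρ = ⋂ i, {x | |x i - y i| < ρ} := by ext; simp [cube]
  rw [this]
  exact isOpen_iInter_of_finite fun i => isOpen_lt (by fun_prop) continuous_const

lemma isBounded_cube (N : ℕ) (y : EuclideanSpace ℝ (Fin N)) (ρ : ℝ) :
    Bornology.IsBounded (cube N y ρ) := by
  refine (Metric.isBounded_closedBall (x := y) (r := √(∑ _i : Fin N, ρ ^ 2))).subset fun x hx => ?_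
  rw [Metric.mem_closedBall, EuclideanSpace.dist_eq]
  refine Real.sqrt_le_sqrt (Finset.sum_le_sum fun i _ => ?_)
  rw [Real.dist_eq]
  exact pow_le_pow_left₀ (abs_nonneg _) (hx i).le 2

lemma hasCompactSupport_indicator {P : Type*} [PseudoMetricSpace P] [ProperSpace P] {Q : Set P}
    (hQ : Bornology.IsBounded Q) (f : P → ℝ) : HasCompactSupport (Q.indicator f) :=
  hQ.isCompact_closure.of_isClosed_subset (isClosed_tsupport _)
    (closure_mono Set.support_indicator_subset)

variable {N : ℕ}

instance isAddHaarMeasure_volume_cylinder :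
    (volume : Measure (EuclideanSpace ℝ (Fin N) × ℝ)).IsAddHaarMeasure :=
  inferInstanceAs (Measure.prod volume volume).IsAddHaarMeasure

lemma sum_smul_single (v : EuclideanSpace ℝ (Fin N)) :
    ∑ i, v i • (EuclideanSpace.single i (1 : ℝ)) = v := by
  ext j
  simp [Finset.sum_apply, Pi.single_apply]

lemma clm_prod_zero_eq_sum (T : EuclideanSpace ℝ (Fin N) × ℝ →L[ℝ] ℝ)
    (v : EuclideanSpace ℝ (Fin N)) :
    T (v, 0) = ∑ i, v i * T (EuclideanSpace.single i 1, 0) := by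
  have h : (v, (0 : ℝ)) = ∑ i, v i • ((EuclideanSpace.single i (1 : ℝ), (0 : ℝ)) :
      EuclideanSpace ℝ (Fin N) × ℝ) := by
    apply Prod.ext
    · rw [Prod.fst_sum]; simp [sum_smul_single]
    · rw [Prod.snd_sum]; simp
  rw [h, map_sum]
  simp only [map_smul, smul_eq_mul]

lemma abs_apply_le_norm (v : EuclideanSpace ℝ (Fin N)) (i : Fin N) : |v i| ≤ ‖v‖ :=
  PiLp.norm_apply_le v i

/-- Smooth compactly supported functions are test functions. -/
lemma isTestFunction_of_contDiff {K : Set (EuclideanSpace ℝ (Fin N))} {T0 T1 : ℝ}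
    {φ : EuclideanSpace ℝ (Fin N) × ℝ → ℝ} (hK : IsOpen K) (hφ : ContDiff ℝ (⊤ : ℕ∞) φ)
    (hc : HasCompactSupport φ) (hs : tsupport φ ⊆ K ×ˢ Ioo T0 T1) :
    IsTestFunction K T0 T1 fun x t => φ (x, t) where
  lipschitz := by
    obtain ⟨C, hC⟩ := hφ.lipschitzWith_of_hasCompactSupport hc (by simp)
    exact ⟨C, hC.lipschitzOnWith⟩
  vanishes := by
    refine ⟨(tsupport φ)ᶜ, (isClosed_tsupport φ).isOpen_compl, ?_, fun p hp =>
      image_eq_zero_of_notMem_tsupport hp.1⟩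
    rintro p hp hps
    have hpQ := hs hps
    rcases hp with hp | hp
    · rw [hK.frontier_eq] at hp
      exact hp.1.2 hpQ.1
    · exact absurd hp.2 (ne_of_gt hpQ.2.1)

variable {C0 C1 g0 g1 : ℝ} {g : ℝ → ℝ} {K : Set (EuclideanSpace ℝ (Fin N))} {T0 T1 : ℝ}
  {u : EuclideanSpace ℝ (Fin N) → ℝ → ℝ}
  {V a : EuclideanSpace ℝ (Fin N) → ℝ → EuclideanSpace ℝ (Fin N)}

lemma setIntegral_prod_eq_intervalIntegral {f : EuclideanSpace ℝ (Fin N) × ℝ → ℝ} (hT : T0 ≤ T1)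
    (hf : IntegrableOn f (K ×ˢ Ioo T0 T1)) :
    ∫ p in K ×ˢ Ioo T0 T1, f p = ∫ t in T0..T1, ∫ x in K, f (x, t) := by
  rw [intervalIntegral.integral_of_le hT, integral_Ioc_eq_integral_Ioo]
  rw [IntegrableOn, Measure.volume_eq_prod, ← Measure.prod_restrict] at hf
  rw [Measure.volume_eq_prod, ← Measure.prod_restrict]
  exact integral_prod_symm f hf

lemma IsBoundedWeakSolution.integral_mul_fderiv_eq
    (hK : IsOpen K) (hT : T0 ≤ T1)
    (hu : IntegrableOn (fun p : EuclideanSpace ℝ (Fin N) × ℝ => u p.1 p.2) (K ×ˢ Ioo T0 T1))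
    (ha : IntegrableOn (fun p : EuclideanSpace ℝ (Fin N) × ℝ => a p.1 p.2) (K ×ˢ Ioo T0 T1))
    (hweak : ∀ φ : EuclideanSpace ℝ (Fin N) → ℝ → ℝ, IsTestFunction K T0 T1 φ →
      ∀ τ1 τ2 : ℝ, T0 ≤ τ1 → τ1 ≤ τ2 → τ2 ≤ T1 →
        (∫ x in K, u x τ2 * φ x τ2) - (∫ x in K, u x τ1 * φ x τ1) =
          ∫ t in τ1..τ2, ∫ x in K,
            (u x t * deriv (φ x) t - fderiv ℝ (fun y => φ y t) x (a x t)))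
    {φ : EuclideanSpace ℝ (Fin N) × ℝ → ℝ} (hφ : ContDiff ℝ (⊤ : ℕ∞) φ)
    (hc : HasCompactSupport φ) (hs : tsupport φ ⊆ K ×ˢ Ioo T0 T1) :
    ∫ p in K ×ˢ Ioo T0 T1, u p.1 p.2 * fderiv ℝ φ p (0, 1) =
      ∑ i, ∫ p in K ×ˢ Ioo T0 T1, a p.1 p.2 i * fderiv ℝ φ p (EuclideanSpace.single i 1, 0) := by
  have hd : ∀ p, HasFDerivAt φ (fderiv ℝ φ p) p := fun p =>
    (hφ.differentiable (by simp) p).hasFDerivAt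
  have hcont : Continuous (fderiv ℝ φ) := hφ.continuous_fderiv (by simp)
  obtain ⟨C, hC⟩ := (hc.fderiv ℝ).exists_bound_of_continuous hcont
  have hbdd : ∀ v : EuclideanSpace ℝ (Fin N) × ℝ, ∀ p, ‖fderiv ℝ φ p v‖ ≤ C * ‖v‖ := fun v p =>
    ((fderiv ℝ φ p).le_opNorm v).trans (mul_le_mul_of_nonneg_right (hC p) (norm_nonneg v))
  have hcv : ∀ v : EuclideanSpace ℝ (Fin N) × ℝ, Continuous fun p => fderiv ℝ φ p v := fun v =>
    hcont.clm_apply continuous_const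
  have hi1 : IntegrableOn (fun p => u p.1 p.2 * fderiv ℝ φ p (0, 1)) (K ×ˢ Ioo T0 T1) :=
    hu.mul_bdd (hcv _).aestronglyMeasurable (Eventually.of_forall (hbdd _))
  have hai : ∀ i, IntegrableOn (fun p : EuclideanSpace ℝ (Fin N) × ℝ => a p.1 p.2 i)
      (K ×ˢ Ioo T0 T1) := fun i => (EuclideanSpace.proj (𝕜 := ℝ) i).integrable_comp ha
  have hi2 : ∀ i, IntegrableOn (fun p => a p.1 p.2 i *
      fderiv ℝ φ p (EuclideanSpace.single i 1, 0)) (K ×ˢ Ioo T0 T1) := fun i =>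
    (hai i).mul_bdd (hcv _).aestronglyMeasurable (Eventually.of_forall (hbdd _))
  have h0 := hweak _ (isTestFunction_of_contDiff hK hφ hc hs) T0 T1 le_rfl hT le_rfl
  have hz : ∀ t, t ∉ Ioo T0 T1 → ∀ x, φ (x, t) = 0 := fun t ht x =>
    image_eq_zero_of_notMem_tsupport fun hmem => ht (hs hmem).2
  have hl : (∫ x in K, u x T1 * φ (x, T1)) - (∫ x in K, u x T0 * φ (x, T0)) = 0 := by
    simp [hz T1 (by simp), hz T0 (by simp)]
  rw [hl] at h0
  have hdt : ∀ x t, deriv (fun s => φ (x, s)) t = fderiv ℝ φ (x, t) (0, 1) := by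
    intro x t
    have h1 : HasDerivAt (fun s : ℝ => (x, s)) ((0 : EuclideanSpace ℝ (Fin N)), (1 : ℝ)) t :=
      (hasDerivAt_const t x).prodMk (hasDerivAt_id t)
    exact ((hd (x, t)).comp_hasDerivAt t h1).deriv
  have hdx : ∀ x t v, fderiv ℝ (fun y => φ (y, t)) x v = fderiv ℝ φ (x, t) (v, 0) := by
    intro x t v
    have h1 : HasFDerivAt (fun y : EuclideanSpace ℝ (Fin N) => (y, t))
        ((ContinuousLinearMap.id ℝ _).prod 0) x :=
      (hasFDerivAt_id x).prodMk (hasFDerivAt_const t x)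
    have h2 := ((hd (x, t)).comp x h1).fderiv
    change fderiv ℝ (φ ∘ fun y => (y, t)) x v = _
    rw [h2]
    simp
  simp_rw [hdt, hdx, fun x t => clm_prod_zero_eq_sum (fderiv ℝ φ (x, t)) (a x t)] at h0
  have hi3 : IntegrableOn (fun p => ∑ i, a p.1 p.2 i *
      fderiv ℝ φ p (EuclideanSpace.single i 1, 0)) (K ×ˢ Ioo T0 T1) :=
    integrable_finsetSum _ fun i _ => hi2 i
  have h3 := setIntegral_prod_eq_intervalIntegral hT (hi1.sub hi3)
  simp only [Pi.sub_apply] at h3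
  rw [← h0, integral_sub hi1 hi3, integral_finsetSum _ fun i _ => hi2 i] at h3
  linarith

/-- The energy identity for bounded weak solutions, tested with `f' u * θ`. -/
lemma IsBoundedWeakSolution.energy_identity (hsol : IsBoundedWeakSolution C0 C1 g K T0 T1 u V)
    (hg : IsStructureFunction g0 g1 g) (h1 : 1 < g1) (hC1 : 0 < C1) (hK : IsOpen K)
    (hKb : Bornology.IsBounded K) (hT : T0 ≤ T1) (hu0 : ∀ x ∈ K, ∀ t ∈ Icc T0 T1, 0 ≤ u x t) :
    ∃ a : EuclideanSpace ℝ (Fin N) → ℝ → EuclideanSpace ℝ (Fin N),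
    (∀ᵐ p : EuclideanSpace ℝ (Fin N) × ℝ ∂(volume.restrict (K ×ˢ Ioo T0 T1)),
      C0 * bigG g ‖V p.1 p.2‖ ≤ inner ℝ (a p.1 p.2) (V p.1 p.2) ∧
      ‖a p.1 p.2‖ ≤ C1 * g ‖V p.1 p.2‖) ∧
    ∀ (f f' f'' : ℝ → ℝ), (∀ v, 0 ≤ v → HasDerivAt f (f' v) v) →
      (∀ v, 0 ≤ v → HasDerivAt f' (f'' v) v) → ContinuousOn f'' (Ici 0) →
    ∀ (θ : EuclideanSpace ℝ (Fin N) × ℝ → ℝ) (L : NNReal), LipschitzWith L θ →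
      HasCompactSupport θ → tsupport θ ⊆ K ×ˢ Ioo T0 T1 →
      IntegrableOn (fun p => f'' (u p.1 p.2) * inner ℝ (a p.1 p.2) (V p.1 p.2) * θ p +
          f' (u p.1 p.2) * fderiv ℝ θ p (a p.1 p.2, 0)) (K ×ˢ Ioo T0 T1) ∧
      ∫ p in K ×ˢ Ioo T0 T1, f (u p.1 p.2) * lineDeriv ℝ θ p (0, 1) =
        ∫ p in K ×ˢ Ioo T0 T1, (f'' (u p.1 p.2) * inner ℝ (a p.1 p.2) (V p.1 p.2) * θ p +
          f' (u p.1 p.2) * fderiv ℝ θ p (a p.1 p.2, 0)) := by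
  obtain ⟨a, ham, hab, hweak⟩ := hsol.weak_form
  obtain ⟨M, hM⟩ := hsol.bounded
  refine ⟨a, hab, ?_⟩
  intro f f' f'' hf hf' hf'' θ L hθ hθc hθQ
  set Q : Set (EuclideanSpace ℝ (Fin N) × ℝ) := K ×ˢ Ioo T0 T1 with hQdef
  have hQ : IsOpen Q := hK.prod isOpen_Ioo
  have hQb : Bornology.IsBounded Q := hKb.prod (Metric.isBounded_Ioo T0 T1)
  have hQm : MeasurableSet Q := hQ.measurableSet
  have hQfin : volume Q < ⊤ := hQb.measure_lt_top
  have hQu : ∀ p ∈ Q, 0 ≤ u p.1 p.2 := fun p hp => hu0 _ hp.1 _ (Ioo_subset_Icc_self hp.2)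
  have hone : IntegrableOn (fun _ : EuclideanSpace ℝ (Fin N) × ℝ => (1 : ℝ)) Q :=
    integrableOn_const hQfin.ne
  have hui : IntegrableOn (fun p : EuclideanSpace ℝ (Fin N) × ℝ => u p.1 p.2) Q := by
    refine (hone.const_mul M).mono' ?_ ?_
    · exact (hsol.continuousOn.mono (prod_mono_right Ioo_subset_Icc_self)).aestronglyMeasurable hQm
    · exact ae_restrict_of_forall_mem hQm fun p hp => by
        simpa using hM _ hp.1 _ (Ioo_subset_Icc_self hp.2)
  have hGi : IntegrableOn (fun p : EuclideanSpace ℝ (Fin N) × ℝ => bigG g ‖V p.1 p.2‖) Q :=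
    hsol.grad_integrable
  have hVi : IntegrableOn (fun p : EuclideanSpace ℝ (Fin N) × ℝ => V p.1 p.2) Q := by
    refine (hone.add (hGi.const_mul (g 1)⁻¹)).mono' hsol.grad_measurable ?_
    exact Eventually.of_forall fun p => hg.le_one_add_bigG (norm_nonneg _)
  have hai : IntegrableOn (fun p : EuclideanSpace ℝ (Fin N) × ℝ => a p.1 p.2) Q := by
    refine (((hone.const_mul (g1 * bigG g 1)).add (hGi.const_mul g1)).const_mul C1).mono' ham ?_
    filter_upwards [hab] with p hp
    refine hp.2.trans (mul_le_mul_of_nonneg_left ?_ hC1.le)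
    simpa using hg.apply_le_add_bigG h1 (norm_nonneg (V p.1 p.2))
  have hVii : ∀ i, IntegrableOn (fun p : EuclideanSpace ℝ (Fin N) × ℝ => V p.1 p.2 i) Q := fun i =>
    (EuclideanSpace.proj (𝕜 := ℝ) i).integrable_comp hVi
  have haii : ∀ i, IntegrableOn (fun p : EuclideanSpace ℝ (Fin N) × ℝ => a p.1 p.2 i) Q := fun i =>
    (EuclideanSpace.proj (𝕜 := ℝ) i).integrable_comp hai
  set U := Q.indicator fun p => u p.1 p.2 with hU
  set A : Fin N → EuclideanSpace ℝ (Fin N) × ℝ → ℝ := fun i => Q.indicator fun p => a p.1 p.2 i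
    with hA
  set W : Fin N → EuclideanSpace ℝ (Fin N) × ℝ → ℝ := fun i => Q.indicator fun p => V p.1 p.2 i
    with hW
  set w := Q.indicator fun p => C1 * g1 * bigG g ‖V p.1 p.2‖ with hw
  have hind : ∀ (F E : EuclideanSpace ℝ (Fin N) × ℝ → ℝ),
      ∫ p, Q.indicator F p * E p = ∫ p in Q, F p * E p := by
    intro F E
    rw [← integral_indicator hQm]
    simp_rw [Set.indicator_mul_left]
  have hU0 : ∀ p, 0 ≤ U p := fun p => indicator_nonneg hQu p
  have hM0 : ∀ p, U p ≤ max M 0 := by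
    intro p
    by_cases hp : p ∈ Q
    · rw [hU, indicator_of_mem hp]
      exact (le_abs_self _).trans ((hM _ hp.1 _ (Ioo_subset_Icc_self hp.2)).trans (le_max_left _ _))
    · rw [hU, indicator_of_notMem hp]
      exact le_max_right _ _
  have hUi : Integrable U := hui.integrable_indicator hQm
  have hAi : ∀ i, Integrable (A i) := fun i => (haii i).integrable_indicator hQm
  have hWi : ∀ i, Integrable (W i) := fun i => (hVii i).integrable_indicator hQm
  have hwi : Integrable w := IntegrableOn.integrable_indicator (hGi.const_mul (C1 * g1)) hQm
  have hw0 : ∀ p, 0 ≤ w p := fun p => indicator_nonneg (fun p _ =>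
    mul_nonneg (mul_nonneg hC1.le (by linarith)) (hg.bigG_nonneg (norm_nonneg _))) p
  have hAW : ∀ i, ∀ᵐ y, ∀ z, |A i y| * |W i z| ≤ w y + w z := by
    intro i
    rw [ae_restrict_iff' hQm] at hab
    filter_upwards [hab] with y hy z
    by_cases hyQ : y ∈ Q
    · by_cases hzQ : z ∈ Q
      · simp only [hA, hW, hw, indicator_of_mem hyQ, indicator_of_mem hzQ]
        have h2 := hg.apply_mul_le_add h1 (norm_nonneg (V y.1 y.2)) (norm_nonneg (V z.1 z.2))
        calc |a y.1 y.2 i| * |V z.1 z.2 i| ≤ (C1 * g ‖V y.1 y.2‖) * ‖V z.1 z.2‖ :=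
              mul_le_mul ((abs_apply_le_norm _ _).trans (hy hyQ).2) (abs_apply_le_norm _ _)
                (abs_nonneg _) (mul_nonneg hC1.le (hg.nonneg _ (norm_nonneg _)))
          _ = C1 * (g ‖V y.1 y.2‖ * ‖V z.1 z.2‖) := by ring
          _ ≤ C1 * (g1 * (bigG g ‖V y.1 y.2‖ + bigG g ‖V z.1 z.2‖)) :=
              mul_le_mul_of_nonneg_left h2 hC1.le
          _ = _ := by ring
      · simp only [hW, indicator_of_notMem hzQ, abs_zero, mul_zero]
        exact add_nonneg (hw0 y) (hw0 z)
    · simp only [hA, indicator_of_notMem hyQ, abs_zero, zero_mul]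
      exact add_nonneg (hw0 y) (hw0 z)
  have hf'c : ContinuousOn f' (Ici 0) := fun v hv => (hf' v hv).continuousAt.continuousWithinAt
  have hid := integral_comp_mul_lineDeriv (μ := (volume : Measure (EuclideanSpace ℝ (Fin N) × ℝ)))
    (τ := (0, 1)) (e := fun i : Fin N => (EuclideanSpace.single i (1 : ℝ), (0 : ℝ)))
    hQ hUi (hasCompactSupport_indicator hQb _) hU0 hM0 hAi
    (fun i => hasCompactSupport_indicator hQb _) hWi hwi hAW
    (fun φ h2 h3 h4 i => by
      simp_rw [hU, hW, hind]
      exact hsol.weak_gradient φ h2 h3 h4 i)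
    (fun φ h2 h3 h4 => by
      simp_rw [hU, hA, hind]
      exact IsBoundedWeakSolution.integral_mul_fderiv_eq hK hT hui hai hweak h2 h3 h4)
    hf hf' hf'' hθ hθc hθQ
  obtain ⟨Cθ, hCθ⟩ := hθc.exists_bound_of_continuous hθ.continuous
  have hint : ∀ i, Integrable (fun x => f'' (U x) * (A i x * W i x) * θ x + f' (U x) * A i x *
      lineDeriv ℝ θ x (EuclideanSpace.single i (1 : ℝ), (0 : ℝ))) := fun i =>
    (integrable_comp_mul_mul hUi hU0 hM0 (hAi i) (hWi i) (hwi.add hwi)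
      ((hAW i).mono fun y hy => by rw [abs_mul]; exact hy y) hf''
      hθ.continuous.aestronglyMeasurable hCθ).add
      (integrable_comp_mul_lineDeriv hUi hU0 hM0 (hAi i) hf'c hθ _)
  rw [← integral_finsetSum _ fun i _ => hint i] at hid
  have hsum := integrable_finsetSum Finset.univ fun i _ => hint i
  have hae : (fun x => ∑ i, (f'' (U x) * (A i x * W i x) * θ x + f' (U x) * A i x *
      lineDeriv ℝ θ x (EuclideanSpace.single i (1 : ℝ), (0 : ℝ)))) =ᵐ[volume]
      Q.indicator fun p => f'' (u p.1 p.2) * inner ℝ (a p.1 p.2) (V p.1 p.2) * θ p +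
          f' (u p.1 p.2) * fderiv ℝ θ p (a p.1 p.2, 0) := by
    filter_upwards [hθ.ae_differentiableAt (μ := volume)] with x hx
    by_cases hxQ : x ∈ Q
    · rw [indicator_of_mem hxQ]
      simp only [hU, hA, hW, indicator_of_mem hxQ]
      rw [clm_prod_zero_eq_sum, Finset.sum_add_distrib, ← Finset.sum_mul, ← Finset.mul_sum,
        PiLp.inner_apply]
      congr 1
      · congr 2
        exact Finset.sum_congr rfl fun i _ => by simp [mul_comm]
      · rw [Finset.mul_sum]
        refine Finset.sum_congr rfl fun i _ => ?_
        rw [hx.lineDeriv_eq_fderiv]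
        ring
    · simp [hA, indicator_of_notMem hxQ]
  constructor
  · have := hsum.congr hae
    rwa [integrable_indicator_iff hQm] at this
  · rw [integral_congr_ae hae, integral_indicator hQm] at hid
    rw [← hid, ← integral_indicator hQm]
    congr 1
    ext x
    by_cases hxQ : x ∈ Q
    · simp [hU, indicator_of_mem hxQ]
    · rw [indicator_of_notMem hxQ, lineDeriv_eq_zero_of_notMem_tsupport (fun h => hxQ (hθQ h)),
        mul_zero]

end Cylinder

/-- The pointwise inequality absorbing the flux term into the coercive term. -/
lemma neg_energy_density_le {C0 C1 g0 g1 q ε k δ v z d s I D : ℝ} {g : ℝ → ℝ}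
    (hg : IsStructureFunction g0 g1 g) (h1 : 1 < g1) (hC0 : 0 < C0) (hC1 : 0 < C1) (hq : g1 ≤ q)
    (hε : 0 < ε) (hε1 : ε ≤ 1) (hεC : q * C1 * ε * g1 ≤ C0) (hk : 0 < k) (hδ : 0 < δ)
    (hv : 0 ≤ v) (hz : 0 ≤ z) (hz1 : z ≤ 1) (hd : 0 ≤ d) (hs : 0 ≤ s)
    (hI : C0 * bigG g s ≤ I) (hD : |D| ≤ d * (C1 * g s)) :
    -(logEnergyDeriv₂ g k δ v * I * z ^ q + logEnergyDeriv g k δ v * (q * z ^ (q - 1) * D)) ≤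
      2 * (q * C1 * ε * g1 * ε⁻¹ ^ g1) * (smallH g (logPsi k δ v ^ 2) * |logPsi k δ v| *
        |logPsi' k δ v| ^ 2 * bigG g (d / |logPsi' k δ v|) * z ^ (q - g1)) := by
  have hP : 0 < |logPsi' k δ v| := by
    have := logDenom_pos hk hδ hv
    rw [logPsi', abs_pos]
    exact div_ne_zero (by norm_num) this.ne'
  have hF'' := le_logEnergyDeriv₂ hg hk hδ hv
  have hF' := logEnergyDeriv_eq g hk hδ hv
  rw [abs_of_nonneg (logPsi_nonneg k δ v)]
  have hX : 0 ≤ smallH g (logPsi k δ v ^ 2) * logPsi k δ v :=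
    mul_nonneg (hg.smallH_nonneg (sq_nonneg _)) (logPsi_nonneg k δ v)
  set P := |logPsi' k δ v|
  rw [mul_assoc 2] at hF'' hF'
  set X := smallH g (logPsi k δ v ^ 2) * logPsi k δ v
  have hGs := hg.bigG_nonneg hs
  have hdP : 0 ≤ d / P := by positivity
  have hGd := hg.bigG_nonneg hdP
  have hq0 : 0 < q := by linarith
  have hI0 : 0 ≤ I := (by positivity : 0 ≤ C0 * bigG g s).trans hI
  have hE0 : 0 ≤ ε⁻¹ ^ g1 := by positivity
  rcases eq_or_lt_of_le hz with rfl | hz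
  · rw [Real.zero_rpow hq0.ne', Real.zero_rpow (by linarith : q - 1 ≠ 0)]
    simp only [mul_zero, zero_mul, add_zero, neg_zero]
    positivity
  have hzq : 0 < z ^ q := Real.rpow_pos_of_pos hz q
  have hb : 0 ≤ z⁻¹ * (d / P) := by positivity
  have hy := hg.apply_mul_le h1 hs hb hε hε1
  have hscale : bigG g (z⁻¹ * (d / P)) * z ^ q ≤ bigG g (d / P) * z ^ (q - g1) := by
    have h2 := hg.bigG_mul_le (one_le_inv₀ hz |>.2 hz1) hdP
    rw [Real.inv_rpow hz.le] at h2
    rw [Real.rpow_sub hz]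
    calc bigG g (z⁻¹ * (d / P)) * z ^ q ≤ ((z ^ g1)⁻¹ * bigG g (d / P)) * z ^ q :=
          mul_le_mul_of_nonneg_right h2 hzq.le
      _ = _ := by ring
  have hcoer : 2 * X * P ^ 2 * (C0 * bigG g s) * z ^ q ≤ logEnergyDeriv₂ g k δ v * I * z ^ q :=
    mul_le_mul_of_nonneg_right (mul_le_mul hF'' hI (by positivity)
      ((by positivity : 0 ≤ 2 * X * P ^ 2).trans hF'')) hzq.le
  have hflux : 2 * X * P * (q * z ^ (q - 1) * D) ≤ 2 * X * P ^ 2 * (q * C1) * z ^ q *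
      (ε * g1 * bigG g s + ε * g1 * (ε⁻¹ ^ g1 * bigG g (z⁻¹ * (d / P)))) := by
    have hzq1 : z ^ (q - 1) = z ^ q * z⁻¹ := by
      rw [Real.rpow_sub hz, Real.rpow_one, div_eq_mul_inv]
    calc 2 * X * P * (q * z ^ (q - 1) * D) ≤ 2 * X * P * (q * z ^ (q - 1) * (d * (C1 * g s))) := by
          have := (le_abs_self D).trans hD
          gcongr
      _ = 2 * X * P ^ 2 * (q * C1) * z ^ q * (g s * (z⁻¹ * (d / P))) := by
          rw [hzq1]; field_simp
      _ ≤ _ := mul_le_mul_of_nonneg_left hy (by positivity)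
  have habs : 2 * X * P ^ 2 * (q * C1) * z ^ q * (ε * g1 * bigG g s) ≤
      2 * X * P ^ 2 * (C0 * bigG g s) * z ^ q := by
    calc _ = 2 * X * P ^ 2 * ((q * C1 * ε * g1) * bigG g s) * z ^ q := by ring
      _ ≤ _ := by gcongr
  have hlast : 2 * X * P ^ 2 * (q * C1) * z ^ q *
      (ε * g1 * (ε⁻¹ ^ g1 * bigG g (z⁻¹ * (d / P)))) ≤
      2 * (q * C1 * ε * g1 * ε⁻¹ ^ g1) * (X * P ^ 2 * bigG g (d / P) * z ^ (q - g1)) := by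
    calc _ = 2 * (q * C1 * ε * g1 * ε⁻¹ ^ g1) * (X * P ^ 2) *
          (bigG g (z⁻¹ * (d / P)) * z ^ q) := by ring
      _ ≤ 2 * (q * C1 * ε * g1 * ε⁻¹ ^ g1) * (X * P ^ 2) *
          (bigG g (d / P) * z ^ (q - g1)) := mul_le_mul_of_nonneg_left hscale (by positivity)
      _ = _ := by ring
  rw [hF']
  have hexp : 2 * X * P ^ 2 * (q * C1) * z ^ q *
      (ε * g1 * bigG g s + ε * g1 * (ε⁻¹ ^ g1 * bigG g (z⁻¹ * (d / P)))) =
      2 * X * P ^ 2 * (q * C1) * z ^ q * (ε * g1 * bigG g s) + 2 * X * P ^ 2 * (q * C1) * z ^ q *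
      (ε * g1 * (ε⁻¹ ^ g1 * bigG g (z⁻¹ * (d / P)))) := by ring
  linarith

section Cutoff

variable {E : Type*} [NormedAddCommGroup E] [NormedSpace ℝ E]

lemma exists_mem_frontier_segment {K : Set E} (hK : IsOpen K) {x y : E} (hx : x ∈ K)
    (hy : y ∉ K) : ∃ z ∈ segment ℝ x y, z ∈ frontier K := by
  by_contra! hcon
  have hsub : segment ℝ x y ⊆ K ∪ (closure K)ᶜ := by
    intro z hz
    by_cases hzK : z ∈ K
    · exact Or.inl hzK
    · refine Or.inr fun hzc => hcon z hz ?_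
      rw [hK.frontier_eq]
      exact ⟨hzc, hzK⟩
  have hyc : y ∈ (closure K)ᶜ := by
    rcases hsub (right_mem_segment ℝ x y) with h | h
    · exact absurd h hy
    · exact h
  obtain ⟨z, -, hz1, hz2⟩ := (convex_segment (𝕜 := ℝ) x y).isPreconnected K (closure K)ᶜ hK
    isClosed_closure.isOpen_compl hsub ⟨x, left_mem_segment ℝ x y, hx⟩
    ⟨y, right_mem_segment ℝ x y, hyc⟩
  exact hz2 (subset_closure hz1)

/-- Extension by zero of a Lipschitz function vanishing on the boundary. -/
lemma lipschitzWith_indicator {K : Set E} (hK : IsOpen K) {ζ : E → ℝ} {L : NNReal}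
    (hζ : LipschitzOnWith L ζ (closure K)) (h0 : ∀ x ∈ frontier K, ζ x = 0) :
    LipschitzWith L (K.indicator ζ) := by
  have key : ∀ x ∈ K, ∀ y ∉ K, |ζ x| ≤ L * dist x y := by
    intro x hx y hy
    obtain ⟨z, hz, hzf⟩ := exists_mem_frontier_segment hK hx hy
    have h1 := hζ.dist_le_mul x (subset_closure hx) z (frontier_subset_closure hzf)
    rw [h0 z hzf, Real.dist_0_eq_abs] at h1
    refine h1.trans (mul_le_mul_of_nonneg_left ?_ L.2)
    have h2 := dist_add_dist_of_mem_segment hz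
    have h3 : 0 ≤ dist z y := dist_nonneg
    linarith
  refine LipschitzWith.of_dist_le_mul fun x y => ?_
  by_cases hx : x ∈ K <;> by_cases hy : y ∈ K
  · rw [indicator_of_mem hx, indicator_of_mem hy]
    exact hζ.dist_le_mul x (subset_closure hx) y (subset_closure hy)
  · rw [indicator_of_mem hx, indicator_of_notMem hy, Real.dist_0_eq_abs]
    exact key x hx y hy
  · rw [indicator_of_notMem hx, indicator_of_mem hy, dist_comm, Real.dist_0_eq_abs, dist_comm]
    exact key y hy x hx
  · rw [indicator_of_notMem hx, indicator_of_notMem hy, dist_self]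
    positivity

end Cutoff

lemma IsCutoff.tsupport_indicator_subset {N : ℕ} {K : Set (EuclideanSpace ℝ (Fin N))}
    {ζ : EuclideanSpace ℝ (Fin N) → ℝ} (hζ : IsCutoff K ζ) (hK : IsOpen K) :
    tsupport (K.indicator ζ) ⊆ K := by
  obtain ⟨U, hU, hUK, hU0⟩ := hζ.vanishes
  have h1 : tsupport (K.indicator ζ) ⊆ closure K \ U := by
    refine closure_minimal (fun x hx => ?_) (isClosed_closure.sdiff hU)
    have hxK : x ∈ K := Set.support_indicator_subset hx
    refine ⟨subset_closure hxK, fun hxU => hx ?_⟩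
    rw [indicator_of_mem hxK]
    exact hU0 x ⟨hxU, subset_closure hxK⟩
  intro x hx
  by_contra hcon
  refine (h1 hx).2 (hUK ?_)
  rw [hK.frontier_eq]
  exact ⟨(h1 hx).1, hcon⟩

lemma IsCutoff.exists_lipschitzWith_indicator {N : ℕ} {K : Set (EuclideanSpace ℝ (Fin N))}
    {ζ : EuclideanSpace ℝ (Fin N) → ℝ} (hζ : IsCutoff K ζ) (hK : IsOpen K) :
    ∃ L, LipschitzWith L (K.indicator ζ) := by
  obtain ⟨L, hL⟩ := hζ.lipschitz
  obtain ⟨U, -, hUK, hU0⟩ := hζ.vanishes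
  exact ⟨L, lipschitzWith_indicator hK hL fun x hx =>
    hU0 x ⟨hUK hx, frontier_subset_closure hx⟩⟩

lemma IsCutoff.indicator_nonneg {N : ℕ} {K : Set (EuclideanSpace ℝ (Fin N))}
    {ζ : EuclideanSpace ℝ (Fin N) → ℝ} (hζ : IsCutoff K ζ) (x : EuclideanSpace ℝ (Fin N)) :
    0 ≤ K.indicator ζ x :=
  Set.indicator_nonneg (fun x hx => (hζ.mem_Icc x (subset_closure hx)).1) x

lemma IsCutoff.indicator_le_one {N : ℕ} {K : Set (EuclideanSpace ℝ (Fin N))}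
    {ζ : EuclideanSpace ℝ (Fin N) → ℝ} (hζ : IsCutoff K ζ) (x : EuclideanSpace ℝ (Fin N)) :
    K.indicator ζ x ≤ 1 :=
  indicator_le' (g := fun _ => 1) (fun x hx => (hζ.mem_Icc x (subset_closure hx)).2)
    (fun _ _ => zero_le_one) x

lemma exists_lipschitzWith_rpow {α : Type*} [PseudoMetricSpace α] {z : α → ℝ} {L : NNReal} {q : ℝ}
    (hq : 1 ≤ q) (hz : LipschitzWith L z) (h0 : ∀ x, 0 ≤ z x) (h1 : ∀ x, z x ≤ 1) :
    ∃ L', LipschitzWith L' fun x => z x ^ q :=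
  exists_lipschitzWith_comp (f := fun s => s ^ q) (f' := fun s => q * s ^ (q - 1)) hz h0 h1
    (fun _ _ => Real.hasDerivAt_rpow_const (Or.inr hq))
    (continuous_const.mul (Real.continuous_rpow_const (by linarith))).continuousOn

/-! ### Time cutoffs -/

section TimeCutoff

/-- A smooth function equal to `0` for `t ≤ c` and to `1` for `t ≥ c + ε`. -/
noncomputable def timeStep (c ε t : ℝ) : ℝ := Real.smoothTransition ((t - c) / ε)

variable {c ε t : ℝ}

lemma contDiff_timeStep : ContDiff ℝ 1 (timeStep c ε) :=
  (Real.smoothTransition.contDiff (n := 1)).comp ((contDiff_id.sub contDiff_const).div_const ε)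

lemma monotone_timeStep (hε : 0 < ε) : Monotone (timeStep c ε) := fun s t h =>
  Real.smoothTransition.monotone (by gcongr)

lemma timeStep_eq_zero (hε : 0 < ε) (ht : t ≤ c) : timeStep c ε t = 0 :=
  Real.smoothTransition.zero_of_nonpos (div_nonpos_of_nonpos_of_nonneg (by linarith) hε.le)

lemma timeStep_eq_one (hε : 0 < ε) (ht : c + ε ≤ t) : timeStep c ε t = 1 :=
  Real.smoothTransition.one_of_one_le (by rw [one_le_div hε]; linarith)

lemma deriv_timeStep_nonneg (hε : 0 < ε) : 0 ≤ deriv (timeStep c ε) t :=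
  (monotone_timeStep hε).deriv_nonneg

lemma deriv_timeStep_eq_zero (hε : 0 < ε) (ht : t ∉ Icc c (c + ε)) :
    deriv (timeStep c ε) t = 0 := by
  rw [mem_Icc, not_and_or, not_le, not_le] at ht
  rcases ht with h | h
  · have : timeStep c ε =ᶠ[𝓝 t] fun _ => 0 := by
      filter_upwards [gt_mem_nhds h] with s hs using timeStep_eq_zero hε (le_of_lt hs)
    rw [this.deriv_eq, deriv_const]
  · have : timeStep c ε =ᶠ[𝓝 t] fun _ => 1 := by
      filter_upwards [lt_mem_nhds h] with s hs using timeStep_eq_one hε (le_of_lt hs)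
    rw [this.deriv_eq, deriv_const]

lemma continuous_deriv_timeStep : Continuous (deriv (timeStep c ε)) :=
  contDiff_timeStep.continuous_deriv le_rfl

lemma integral_deriv_timeStep {a b : ℝ} (hε : 0 < ε) (ha : a ≤ c) (hb : c + ε ≤ b) :
    ∫ t in a..b, deriv (timeStep c ε) t = 1 := by
  rw [intervalIntegral.integral_deriv_eq_sub
    (fun t _ => contDiff_timeStep.differentiable one_ne_zero t)
    (continuous_deriv_timeStep.intervalIntegrable _ _), timeStep_eq_one hε hb,
    timeStep_eq_zero hε ha, sub_zero]

/-- Comparison of endpoint values from tests against smooth time cutoffs. -/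
lemma sub_le_of_forall_timeStep {m : ℝ → ℝ} {t0 t1 B : ℝ} (ht : t0 < t1)
    (hm : ContinuousOn m (Icc t0 t1))
    (h : ∀ ε, 0 < ε → 3 * ε ≤ t1 - t0 →
      -∫ t in t0..t1, m t * (deriv (timeStep (t0 + ε) ε) t - deriv (timeStep (t1 - 2 * ε) ε) t) ≤
        B) : m t1 - m t0 ≤ B := by
  refine le_of_forall_pos_le_add fun e he => ?_
  obtain ⟨d0, hd0, hd0'⟩ := Metric.continuousWithinAt_iff.1 (hm t0 (left_mem_Icc.2 ht.le)) (e / 2)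
    (by positivity)
  obtain ⟨d1, hd1, hd1'⟩ := Metric.continuousWithinAt_iff.1 (hm t1 (right_mem_Icc.2 ht.le)) (e / 2)
    (by positivity)
  obtain ⟨ε, hε, hε0, hε1, hε2⟩ : ∃ ε, 0 < ε ∧ 2 * ε < d0 ∧ 2 * ε < d1 ∧ 3 * ε ≤ t1 - t0 := by
    refine ⟨min (min (d0 / 3) (d1 / 3)) ((t1 - t0) / 3), ?_, ?_, ?_, ?_⟩
    · have : 0 < t1 - t0 := by linarith
      positivity
    · have := (min_le_left (min (d0 / 3) (d1 / 3)) ((t1 - t0) / 3)).trans (min_le_left _ _)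
      linarith
    · have := (min_le_left (min (d0 / 3) (d1 / 3)) ((t1 - t0) / 3)).trans (min_le_right _ _)
      linarith
    · have := min_le_right (min (d0 / 3) (d1 / 3)) ((t1 - t0) / 3)
      linarith
  have hB := h ε hε hε2
  have huIcc : uIcc t0 t1 = Icc t0 t1 := uIcc_of_le ht.le
  have hint : ∀ c, IntervalIntegrable (fun t => m t * deriv (timeStep c ε) t) volume t0 t1 :=
    fun c => ContinuousOn.intervalIntegrable (by
      rw [huIcc]; exact hm.mul continuous_deriv_timeStep.continuousOn)
  have hint' : ∀ c b : ℝ, IntervalIntegrable (fun t => b * deriv (timeStep c ε) t) volume t0 t1 :=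
    fun c b => (continuous_const.mul continuous_deriv_timeStep).intervalIntegrable _ _
  simp_rw [mul_sub] at hB
  rw [intervalIntegral.integral_sub (hint _) (hint _)] at hB
  have hl : ∫ t in t0..t1, m t * deriv (timeStep (t0 + ε) ε) t ≤ m t0 + e / 2 := by
    calc _ ≤ ∫ t in t0..t1, (m t0 + e / 2) * deriv (timeStep (t0 + ε) ε) t := by
          refine intervalIntegral.integral_mono_on ht.le (hint _) (hint' _ _) fun t htt => ?_
          by_cases hc : t ∈ Icc (t0 + ε) (t0 + ε + ε)
          · refine mul_le_mul_of_nonneg_right ?_ (deriv_timeStep_nonneg hε)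
            have h1 := hd0' htt (by
              rw [Real.dist_eq, abs_of_nonneg (by linarith [htt.1])]; linarith [hc.2])
            rw [Real.dist_eq] at h1
            linarith [le_abs_self (m t - m t0)]
          · rw [deriv_timeStep_eq_zero hε hc, mul_zero, mul_zero]
      _ = m t0 + e / 2 := by
          rw [intervalIntegral.integral_const_mul, integral_deriv_timeStep hε (by linarith)
            (by linarith), mul_one]
  have hr : m t1 - e / 2 ≤ ∫ t in t0..t1, m t * deriv (timeStep (t1 - 2 * ε) ε) t := by
    calc m t1 - e / 2 = ∫ t in t0..t1, (m t1 - e / 2) * deriv (timeStep (t1 - 2 * ε) ε) t := by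
          rw [intervalIntegral.integral_const_mul, integral_deriv_timeStep hε (by linarith)
            (by linarith), mul_one]
      _ ≤ _ := by
          refine intervalIntegral.integral_mono_on ht.le (hint' _ _) (hint _) fun t htt => ?_
          by_cases hc : t ∈ Icc (t1 - 2 * ε) (t1 - 2 * ε + ε)
          · refine mul_le_mul_of_nonneg_right ?_ (deriv_timeStep_nonneg hε)
            have h1 := hd1' htt (by
              rw [Real.dist_eq, abs_of_nonpos (by linarith [htt.2])]; linarith [hc.1])
            rw [Real.dist_eq] at h1
            linarith [neg_abs_le (m t - m t1)]
          · rw [deriv_timeStep_eq_zero hε hc, mul_zero, mul_zero]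
  linarith

end TimeCutoff

section LogFlux

lemma continuousOn_logPsi {k δ : ℝ} (hk : 0 < k) (hδ : 0 < δ) :
    ContinuousOn (logPsi k δ) (Ici 0) := by
  have hD : ContinuousOn (logDenom k δ) (Ici 0) :=
    (by unfold logDenom; fun_prop : Continuous (logDenom k δ)).continuousOn
  refine ContinuousOn.sup (ContinuousOn.log (continuousOn_const.div hD fun v hv =>
    (logDenom_pos hk hδ hv).ne') fun v hv => ?_) continuousOn_const
  exact (div_pos hk (logDenom_pos hk hδ hv)).ne'

lemma continuousOn_abs_logPsi' {k δ : ℝ} (hk : 0 < k) (hδ : 0 < δ) :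
    ContinuousOn (fun v => |logPsi' k δ v|) (Ici 0) := by
  have hD : ContinuousOn (logDenom k δ) (Ici 0) :=
    (by unfold logDenom; fun_prop : Continuous (logDenom k δ)).continuousOn
  exact (continuousOn_const.div hD fun v hv => (logDenom_pos hk hδ hv).ne').abs

lemma inv_abs_logPsi'_le {k δ v : ℝ} (hk : 0 < k) (hδ : 0 < δ) (hv : 0 ≤ v) :
    |logPsi' k δ v|⁻¹ ≤ (1 + δ) * k := by
  have hD := logDenom_pos hk hδ hv
  rw [logPsi', abs_div, abs_neg, abs_one, one_div, inv_inv, abs_of_pos hD, logDenom]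
  linarith [le_max_right (k - v) 0]

variable {N : ℕ} {g0 g1 q k δ T0 T1 M : ℝ} {g : ℝ → ℝ} {K : Set (EuclideanSpace ℝ (Fin N))}
  {u : EuclideanSpace ℝ (Fin N) → ℝ → ℝ} {ζ : EuclideanSpace ℝ (Fin N) → ℝ}

lemma integrableOn_logFlux (hg : IsStructureFunction g0 g1 g) (h0 : 1 < g0) (hq : g1 ≤ q)
    (hk : 0 < k) (hδ : 0 < δ) (hK : IsOpen K) (hKb : Bornology.IsBounded K)
    (hu : ContinuousOn (fun p : EuclideanSpace ℝ (Fin N) × ℝ => u p.1 p.2) (K ×ˢ Ioo T0 T1))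
    (hu0 : ∀ p ∈ K ×ˢ Ioo T0 T1, 0 ≤ u p.1 p.2) (huM : ∀ p ∈ K ×ˢ Ioo T0 T1, u p.1 p.2 ≤ M)
    (hζ : IsCutoff K ζ) :
    IntegrableOn (fun p : EuclideanSpace ℝ (Fin N) × ℝ =>
      smallH g (logPsi k δ (u p.1 p.2) ^ 2) * |logPsi k δ (u p.1 p.2)| *
        |logPsi' k δ (u p.1 p.2)| ^ 2 *
        bigG g (‖fderiv ℝ ζ p.1‖ / |logPsi' k δ (u p.1 p.2)|) * ζ p.1 ^ (q - g1))
      (K ×ˢ Ioo T0 T1) := by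
  have hQm : MeasurableSet (K ×ˢ Ioo T0 T1) := (hK.prod isOpen_Ioo).measurableSet
  have hQfin : volume (K ×ˢ Ioo T0 T1) < ⊤ :=
    (hKb.prod (Metric.isBounded_Ioo T0 T1)).measure_lt_top
  obtain ⟨L, hL⟩ := hζ.lipschitz
  have hcoef : ContinuousOn (fun v => smallH g (logPsi k δ v ^ 2) * |logPsi k δ v| *
      |logPsi' k δ v| ^ 2) (Ici 0) :=
    (((hg.continuousOn_smallH h0).comp ((continuousOn_logPsi hk hδ).pow 2)
      fun v _ => mem_Ici.2 (sq_nonneg _)).mul (continuousOn_logPsi hk hδ).abs).mul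
      ((continuousOn_abs_logPsi' hk hδ).pow 2)
  obtain ⟨C, hC0, hC⟩ := exists_abs_le_of_continuousOn hcoef M
  have hm1 : AEStronglyMeasurable (fun p : EuclideanSpace ℝ (Fin N) × ℝ =>
      smallH g (logPsi k δ (u p.1 p.2) ^ 2) * |logPsi k δ (u p.1 p.2)| *
        |logPsi' k δ (u p.1 p.2)| ^ 2) (volume.restrict (K ×ˢ Ioo T0 T1)) :=
    (hcoef.comp hu hu0).aestronglyMeasurable hQm
  have hm2 : AEStronglyMeasurable (fun p : EuclideanSpace ℝ (Fin N) × ℝ =>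
      bigG g (‖fderiv ℝ ζ p.1‖ / |logPsi' k δ (u p.1 p.2)|))
      (volume.restrict (K ×ˢ Ioo T0 T1)) := by
    refine aestronglyMeasurable_comp_nonneg hg.continuousOn_bigG ?_ fun p => by positivity
    exact (((measurable_fderiv ℝ ζ).comp measurable_fst).norm.aestronglyMeasurable).div₀
      (((continuousOn_abs_logPsi' hk hδ).comp hu hu0).aestronglyMeasurable hQm)
  have hm3 : AEStronglyMeasurable (fun p : EuclideanSpace ℝ (Fin N) × ℝ => ζ p.1 ^ (q - g1))
      (volume.restrict (K ×ˢ Ioo T0 T1)) := by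
    refine ContinuousOn.aestronglyMeasurable (ContinuousOn.rpow_const ?_ fun p _ =>
      Or.inr (by linarith)) hQm
    exact hL.continuousOn.comp continuousOn_fst fun p hp => subset_closure hp.1
  have hone : IntegrableOn (fun _ : EuclideanSpace ℝ (Fin N) × ℝ =>
      C * bigG g (L * ((1 + δ) * k)) * 1) (K ×ˢ Ioo T0 T1) := integrableOn_const hQfin.ne
  refine hone.mono' ((hm1.mul hm2).mul hm3) (ae_restrict_of_forall_mem hQm fun p hp => ?_)
  rw [Real.norm_eq_abs, abs_mul, abs_mul]
  have hd : ‖fderiv ℝ ζ p.1‖ / |logPsi' k δ (u p.1 p.2)| ≤ L * ((1 + δ) * k) := by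
    rw [div_eq_mul_inv]
    exact mul_le_mul (norm_fderiv_le_of_lipschitzOn ℝ
      (mem_of_superset (hK.mem_nhds hp.1) subset_closure) hL)
      (inv_abs_logPsi'_le hk hδ (hu0 p hp)) (by positivity) L.2
  have hd0 : 0 ≤ ‖fderiv ℝ ζ p.1‖ / |logPsi' k δ (u p.1 p.2)| := by positivity
  have hz := hζ.mem_Icc p.1 (subset_closure hp.1)
  have h3 : |ζ p.1 ^ (q - g1)| ≤ 1 := by
    rw [abs_of_nonneg (Real.rpow_nonneg hz.1 _)]
    exact Real.rpow_le_one hz.1 hz.2 (by linarith)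
  have h2 : |bigG g (‖fderiv ℝ ζ p.1‖ / |logPsi' k δ (u p.1 p.2)|)| ≤
      bigG g (L * ((1 + δ) * k)) := by
    rw [abs_of_nonneg (hg.bigG_nonneg hd0)]
    exact hg.monotoneOn_bigG hd0 (hd0.trans hd) hd
  exact mul_le_mul (mul_le_mul (hC _ (hu0 p hp) (huM p hp)) h2 (abs_nonneg _) hC0) h3
    (abs_nonneg _) (mul_nonneg hC0 ((abs_nonneg _).trans h2))

/-- Continuity in time of the energy. -/
lemma continuousOn_integral_comp_mul {f : ℝ → ℝ} {ω : EuclideanSpace ℝ (Fin N) → ℝ}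
    (hK : IsOpen K) (hKb : Bornology.IsBounded K)
    (hu : ContinuousOn (fun p : EuclideanSpace ℝ (Fin N) × ℝ => u p.1 p.2) (K ×ˢ Icc T0 T1))
    (hu0 : ∀ x ∈ K, ∀ t ∈ Icc T0 T1, 0 ≤ u x t) (huM : ∀ x ∈ K, ∀ t ∈ Icc T0 T1, u x t ≤ M)
    (hf : ContinuousOn f (Ici 0)) (hω : Continuous ω) (hω1 : ∀ x, |ω x| ≤ 1) :
    ContinuousOn (fun t => ∫ x in K, f (u x t) * ω x) (Icc T0 T1) := by
  obtain ⟨C, hC0, hC⟩ := exists_abs_le_of_continuousOn hf M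
  refine continuousOn_of_dominated (bound := fun _ => C) (fun t ht => ?_) (fun t ht => ?_)
    (integrableOn_const hKb.measure_lt_top.ne) ?_
  · have hut : ContinuousOn (fun x => u x t) K :=
      hu.comp (f := fun x => (x, t)) (by fun_prop) fun x hx => ⟨hx, ht⟩
    exact ((hf.comp hut fun x hx => hu0 x hx t ht).mul hω.continuousOn).aestronglyMeasurable
      hK.measurableSet
  · refine ae_restrict_of_forall_mem hK.measurableSet fun x hx => ?_
    rw [Real.norm_eq_abs, abs_mul]
    calc |f (u x t)| * |ω x| ≤ C * 1 :=
          mul_le_mul (hC _ (hu0 x hx t ht) (huM x hx t ht)) (hω1 x) (abs_nonneg _) hC0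
      _ = C := mul_one C
  · refine ae_restrict_of_forall_mem hK.measurableSet fun x hx => ?_
    have hut : ContinuousOn (fun t => u x t) (Icc T0 T1) :=
      hu.comp (f := fun t => (x, t)) (by fun_prop) fun t ht => ⟨hx, ht⟩
    exact (hf.comp hut fun t ht => hu0 x hx t ht).mul continuousOn_const

end LogFlux

lemma lineDeriv_mul_time {E : Type*} [NormedAddCommGroup E] [NormedSpace ℝ E] (ω : E → ℝ)
    (η : ℝ → ℝ) (p : E × ℝ) :
    lineDeriv ℝ (fun p : E × ℝ => ω p.1 * η p.2) p (0, 1) = ω p.1 * deriv η p.2 := by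
  simp only [lineDeriv, Prod.fst_add, Prod.snd_add, Prod.smul_fst, Prod.smul_snd, smul_zero,
    add_zero, smul_eq_mul, mul_one]
  rw [deriv_const_mul_field, deriv_comp_const_add, add_zero]

lemma lineDeriv_mul_space {E : Type*} [NormedAddCommGroup E] [NormedSpace ℝ E] (ω : E → ℝ)
    (η : ℝ → ℝ) (p : E × ℝ) (v : E) :
    lineDeriv ℝ (fun p : E × ℝ => ω p.1 * η p.2) p (v, 0) = lineDeriv ℝ ω p.1 v * η p.2 := by
  simp only [lineDeriv, Prod.fst_add, Prod.snd_add, Prod.smul_fst, Prod.smul_snd, smul_zero,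
    add_zero]
  rw [deriv_mul_const_field]

lemma tsupport_mul_prod_subset {X : Type*} [TopologicalSpace X] {ω : X → ℝ} {η : ℝ → ℝ}
    {S : Set X} {J : Set ℝ} (hS : IsClosed S) (hJ : IsClosed J) (hω : ∀ x ∉ S, ω x = 0)
    (hη : ∀ t ∉ J, η t = 0) : tsupport (fun p : X × ℝ => ω p.1 * η p.2) ⊆ S ×ˢ J := by
  refine closure_minimal (fun p hp => ?_) (hS.prod hJ)
  by_contra hcon
  rw [mem_prod, not_and_or] at hcon
  rcases hcon with h | h
  · exact hp (by simp [hω _ h])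
  · exact hp (by simp [hη _ h])

/-- The logarithmic energy estimate tested with a time cutoff. -/
lemma IsBoundedWeakSolution.log_energy_timeStep {N : ℕ} {C0 C1 g0 g1 q k δ ε τ T0 T1 : ℝ}
    {g : ℝ → ℝ} {K : Set (EuclideanSpace ℝ (Fin N))} {u : EuclideanSpace ℝ (Fin N) → ℝ → ℝ}
    {V : EuclideanSpace ℝ (Fin N) → ℝ → EuclideanSpace ℝ (Fin N)}
    {ζ : EuclideanSpace ℝ (Fin N) → ℝ}
    (hsol : IsBoundedWeakSolution C0 C1 g K T0 T1 u V) (hg : IsStructureFunction g0 g1 g)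
    (h0 : 1 < g0) (h1 : 1 < g1) (hC0 : 0 < C0) (hC1 : 0 < C1) (hq : g1 ≤ q)
    (hε : 0 < ε) (hε1 : ε ≤ 1) (hεC : q * C1 * ε * g1 ≤ C0) (hk : 0 < k) (hδ : 0 < δ)
    (hK : IsOpen K) (hKb : Bornology.IsBounded K)
    (hu0 : ∀ x ∈ K, ∀ t ∈ Icc T0 T1, 0 ≤ u x t) (hζ : IsCutoff K ζ)
    (hτ : 0 < τ) (hτT : 3 * τ ≤ T1 - T0) :
    -∫ t in T0..T1, (∫ x in K, logEnergy g k δ (u x t) * K.indicator ζ x ^ q) *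
        (deriv (timeStep (T0 + τ) τ) t - deriv (timeStep (T1 - 2 * τ) τ) t) ≤
      2 * (q * C1 * ε * g1 * ε⁻¹ ^ g1) * ∫ t in T0..T1, ∫ x in K,
        smallH g (logPsi k δ (u x t) ^ 2) * |logPsi k δ (u x t)| * |logPsi' k δ (u x t)| ^ 2 *
          bigG g (‖fderiv ℝ ζ x‖ / |logPsi' k δ (u x t)|) * ζ x ^ (q - g1) := by
  have hT : T0 ≤ T1 := by linarith
  obtain ⟨M, hM⟩ := hsol.bounded
  have huM : ∀ x ∈ K, ∀ t ∈ Icc T0 T1, u x t ≤ M := fun x hx t ht =>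
    (le_abs_self _).trans (hM x hx t ht)
  set Q : Set (EuclideanSpace ℝ (Fin N) × ℝ) := K ×ˢ Ioo T0 T1 with hQdef
  have hQm : MeasurableSet Q := (hK.prod isOpen_Ioo).measurableSet
  have hQfin : volume Q < ⊤ := (hKb.prod (Metric.isBounded_Ioo T0 T1)).measure_lt_top
  have hQu0 : ∀ p ∈ Q, 0 ≤ u p.1 p.2 := fun p hp => hu0 _ hp.1 _ (Ioo_subset_Icc_self hp.2)
  have hQuM : ∀ p ∈ Q, u p.1 p.2 ≤ M := fun p hp => huM _ hp.1 _ (Ioo_subset_Icc_self hp.2)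
  have hQu : ContinuousOn (fun p : EuclideanSpace ℝ (Fin N) × ℝ => u p.1 p.2) Q :=
    hsol.continuousOn.mono (prod_mono_right Ioo_subset_Icc_self)
  have hpos : ∀ v : ℝ, 0 ≤ v → 0 < v + δ * k := fun v hv => by positivity
  have hf : ∀ v : ℝ, 0 ≤ v → HasDerivAt (logEnergy g k δ) (logEnergyDeriv g k δ v) v :=
    fun v hv => hg.hasDerivAt_logEnergy h0 hk (hpos v hv)
  have hf' : ∀ v : ℝ, 0 ≤ v → HasDerivAt (logEnergyDeriv g k δ) (logEnergyDeriv₂ g k δ v) v :=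
    fun v hv => hg.hasDerivAt_logEnergyDeriv h0 hk (hpos v hv)
  have hfc : ContinuousOn (logEnergy g k δ) (Ici 0) := fun v hv =>
    (hf v hv).continuousAt.continuousWithinAt
  -- the cutoff in space
  obtain ⟨L, hzL⟩ := hζ.exists_lipschitzWith_indicator hK
  have hz0 := hζ.indicator_nonneg
  have hz1 := hζ.indicator_le_one
  set z := K.indicator ζ
  have hq0 : 0 < q := by linarith
  obtain ⟨Lω, hLω⟩ := exists_lipschitzWith_rpow (q := q) (by linarith) hzL hz0 hz1
  have hω1 : ∀ x, |z x ^ q| ≤ 1 := fun x => by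
    rw [abs_of_nonneg (Real.rpow_nonneg (hz0 x) _)]
    exact Real.rpow_le_one (hz0 x) (hz1 x) hq0.le
  -- the cutoff in time
  set η : ℝ → ℝ := fun t => timeStep (T0 + τ) τ t - timeStep (T1 - 2 * τ) τ t with hη
  have hη0 : ∀ t, 0 ≤ η t := fun t =>
    sub_nonneg.2 (Real.smoothTransition.monotone (by gcongr; linarith))
  have hη1 : ∀ t, η t ≤ 1 := fun t => by
    have h2 := Real.smoothTransition.le_one ((t - (T0 + τ)) / τ)
    have h3 := Real.smoothTransition.nonneg ((t - (T1 - 2 * τ)) / τ)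
    simp only [hη, timeStep]
    linarith
  have hηs : ∀ t ∉ Icc (T0 + τ) (T1 - τ), η t = 0 := by
    intro t ht
    rw [mem_Icc, not_and_or, not_le, not_le] at ht
    rcases ht with h | h
    · simp only [hη]
      rw [timeStep_eq_zero hτ h.le, timeStep_eq_zero hτ (by linarith), sub_zero]
    · simp only [hη]
      rw [timeStep_eq_one hτ (by linarith), timeStep_eq_one hτ (by linarith), sub_self]
  have hηd : ∀ t, deriv η t =
      deriv (timeStep (T0 + τ) τ) t - deriv (timeStep (T1 - 2 * τ) τ) t := fun t =>
    deriv_sub (contDiff_timeStep.differentiable one_ne_zero t)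
      (contDiff_timeStep.differentiable one_ne_zero t)
  have hηc : ContDiff ℝ 1 η := contDiff_timeStep.sub contDiff_timeStep
  have hηcs : HasCompactSupport η := HasCompactSupport.intro isCompact_Icc hηs
  obtain ⟨Lη, hLη⟩ := hηc.lipschitzWith_of_hasCompactSupport hηcs one_ne_zero
  -- the test function
  set θ : EuclideanSpace ℝ (Fin N) × ℝ → ℝ := fun p => z p.1 ^ q * η p.2 with hθ
  obtain ⟨Lθ, hLθ⟩ : ∃ L, LipschitzWith L θ :=
    lipschitzWith_mul_of_bounded (hLω.comp LipschitzWith.prod_fst)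
      (hLη.comp LipschitzWith.prod_snd) (fun p => hω1 p.1)
      (Bg := 1) fun p => by
        rw [abs_of_nonneg (hη0 _)]; exact hη1 _
  have hθs : tsupport θ ⊆ tsupport z ×ˢ Icc (T0 + τ) (T1 - τ) :=
    tsupport_mul_prod_subset (ω := fun x => z x ^ q) (isClosed_tsupport z) isClosed_Icc (fun x hx => by
      rw [image_eq_zero_of_notMem_tsupport hx, Real.zero_rpow hq0.ne']) hηs
  have hθc : HasCompactSupport θ :=
    ((hasCompactSupport_indicator hKb ζ).isCompact.prod isCompact_Icc).of_isClosed_subset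
      (isClosed_tsupport θ) hθs
  have hθQ : tsupport θ ⊆ Q := hθs.trans (prod_mono (hζ.tsupport_indicator_subset hK)
    (Icc_subset_Ioo (by linarith) (by linarith)))
  obtain ⟨a, hab, hid⟩ := hsol.energy_identity hg h1 hC1 hK hKb hT hu0
  obtain ⟨hint, hid⟩ := hid _ _ _ hf hf' (hg.continuousOn_logEnergyDeriv₂ h0 hk hδ) θ Lθ hLθ hθc
    hθQ
  -- the left-hand side as a time integral
  have hleft : ∫ p in Q, logEnergy g k δ (u p.1 p.2) * lineDeriv ℝ θ p (0, 1) =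
      ∫ t in T0..T1, (∫ x in K, logEnergy g k δ (u x t) * z x ^ q) *
        (deriv (timeStep (T0 + τ) τ) t - deriv (timeStep (T1 - 2 * τ) τ) t) := by
    have hd : ∀ p, lineDeriv ℝ θ p (0, 1) = z p.1 ^ q * deriv η p.2 := fun p =>
      lineDeriv_mul_time (fun x => z x ^ q) η p
    have hi : IntegrableOn (fun p => logEnergy g k δ (u p.1 p.2) * lineDeriv ℝ θ p (0, 1)) Q := by
      obtain ⟨C, hC0, hC⟩ := exists_abs_le_of_continuousOn hfc M
      exact (integrable_lineDeriv (μ := volume) hLθ hθc (0, 1)).integrableOn.bdd_mul (c := C)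
        ((hfc.comp hQu hQu0).aestronglyMeasurable hQm)
        (ae_restrict_of_forall_mem hQm fun p hp => hC _ (hQu0 p hp) (hQuM p hp))
    rw [setIntegral_prod_eq_intervalIntegral hT hi]
    simp_rw [hd, hηd, ← mul_assoc, integral_mul_const]
  rw [← hleft, hid, ← integral_neg]
  -- the right-hand side
  have hflux := integrableOn_logFlux hg h0 hq hk hδ hK hKb hQu hQu0 hQuM hζ
  rw [← setIntegral_prod_eq_intervalIntegral hT hflux, ← integral_const_mul]
  refine integral_mono_ae hint.neg (hflux.const_mul _) ?_
  have hζd : ∀ᵐ p : EuclideanSpace ℝ (Fin N) × ℝ, DifferentiableAt ℝ z p.1 :=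
    Measure.quasiMeasurePreserving_fst.ae (hzL.ae_differentiableAt (μ := volume))
  filter_upwards [hab, ae_restrict_mem hQm, ae_restrict_of_ae hζd,
    ae_restrict_of_ae (hLθ.ae_differentiableAt (μ := volume))] with p hp hpQ hpz hpθ
  have hzζ : z =ᶠ[𝓝 p.1] ζ := by
    filter_upwards [hK.mem_nhds hpQ.1] with x hx using indicator_of_mem hx ζ
  have hDω : lineDeriv ℝ (fun x => z x ^ q) p.1 (a p.1 p.2) =
      q * ζ p.1 ^ (q - 1) * fderiv ℝ ζ p.1 (a p.1 p.2) := by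
    have h2 := (hpz.hasFDerivAt.rpow_const (p := q) (Or.inr (by linarith))).hasLineDerivAt
      (a p.1 p.2)
    rw [h2.lineDeriv, hzζ.fderiv_eq, hzζ.eq_of_nhds]
    simp
  have hDθ : fderiv ℝ θ p (a p.1 p.2, 0) =
      q * ζ p.1 ^ (q - 1) * fderiv ℝ ζ p.1 (a p.1 p.2) * η p.2 := by
    rw [← hpθ.lineDeriv_eq_fderiv, ← hDω]
    exact lineDeriv_mul_space (fun x => z x ^ q) η p (a p.1 p.2)
  have hζp := hζ.mem_Icc p.1 (subset_closure hpQ.1)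
  have hpt := neg_energy_density_le hg h1 hC0 hC1 hq hε hε1 hεC hk hδ (hQu0 p hpQ) hζp.1 hζp.2
    (norm_nonneg (fderiv ℝ ζ p.1)) (norm_nonneg (V p.1 p.2)) hp.1
    (((fderiv ℝ ζ p.1).le_opNorm (a p.1 p.2)).trans
      (mul_le_mul_of_nonneg_left hp.2 (norm_nonneg _)))
  rw [hDθ]
  simp only [hθ]
  rw [hzζ.eq_of_nhds]
  set r := smallH g (logPsi k δ (u p.1 p.2) ^ 2) * |logPsi k δ (u p.1 p.2)| *
    |logPsi' k δ (u p.1 p.2)| ^ 2 *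
    bigG g (‖fderiv ℝ ζ p.1‖ / |logPsi' k δ (u p.1 p.2)|) * ζ p.1 ^ (q - g1) with hr
  have hr0 : 0 ≤ r := by
    have h2 := hg.smallH_nonneg (sq_nonneg (logPsi k δ (u p.1 p.2)))
    have h3 := hg.bigG_nonneg
      (show 0 ≤ ‖fderiv ℝ ζ p.1‖ / |logPsi' k δ (u p.1 p.2)| by positivity)
    have h4 := Real.rpow_nonneg hζp.1 (q - g1)
    positivity
  have hCr : 0 ≤ 2 * (q * C1 * ε * g1 * ε⁻¹ ^ g1) * r := by
    have : 0 < g1 := by linarith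
    positivity
  have h5 := mul_le_mul_of_nonneg_right hpt (hη0 p.2)
  have h6 := mul_le_of_le_one_right hCr (hη1 p.2)
  refine le_trans (le_of_eq ?_) (h5.trans h6)
  ring

/-- Logarithmic energy estimate. The constant `C` is chosen after `C0, C1, g1, q` only. -/
theorem logarithmic_energy_estimate (C0 C1 g1 q : ℝ) (hC0 : 0 < C0) (hC1 : 0 < C1)
    (hq : g1 ≤ q) :
    ∃ C : ℝ, 0 < C ∧
    ∀ (N : ℕ) (g0 : ℝ) (g : ℝ → ℝ), 1 ≤ N → 1 < g0 → g0 ≤ g1 → IsStructureFunction g0 g1 g →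
    ∀ (R t0 t1 : ℝ), 0 < R → t0 < t1 →
    ∀ (u : EuclideanSpace ℝ (Fin N) → ℝ → ℝ)
      (V : EuclideanSpace ℝ (Fin N) → ℝ → EuclideanSpace ℝ (Fin N)),
      IsBoundedWeakSolution C0 C1 g (cube N 0 R) t0 t1 u V →
      (∀ x ∈ cube N 0 R, ∀ t ∈ Set.Icc t0 t1, 0 ≤ u x t) →
    ∀ k δ : ℝ, 0 < k → δ ∈ Set.Ioo (0 : ℝ) 1 →
    ∀ ζ : EuclideanSpace ℝ (Fin N) → ℝ, IsCutoff (cube N 0 R) ζ →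
      (∫ x in cube N 0 R, bigH g (logPsi k δ (u x t1) ^ 2) * ζ x ^ q) ≤
        (∫ x in cube N 0 R, bigH g (logPsi k δ (u x t0) ^ 2) * ζ x ^ q) +
        C * ∫ t in t0..t1, ∫ x in cube N 0 R,
          smallH g (logPsi k δ (u x t) ^ 2) * |logPsi k δ (u x t)| * |logPsi' k δ (u x t)| ^ 2 *
            bigG g (‖fderiv ℝ ζ x‖ / |logPsi' k δ (u x t)|) * ζ x ^ (q - g1) := by
  by_cases h1 : 1 < g1
  swap
  · exact ⟨1, one_pos, fun N g0 g _ h0 h01 => absurd (h0.trans_le h01) h1⟩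
  have hq0 : 0 < q := by linarith
  have hg10 : 0 < g1 := by linarith
  set ε := min 1 (C0 / (q * C1 * g1)) with hε
  have hε0 : 0 < ε := by positivity
  have hεC : q * C1 * ε * g1 ≤ C0 := by
    have h2 : ε * (q * C1 * g1) ≤ C0 := by
      rw [← le_div_iff₀ (by positivity)]
      exact min_le_right _ _
    linarith
  refine ⟨2 * (q * C1 * ε * g1 * ε⁻¹ ^ g1), by positivity, ?_⟩
  intro N g0 g _ h0 _ hg R t0 t1 _ ht u V hsol hu0 k δ hk hδ ζ hζ
  have hK := isOpen_cube N 0 R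
  have hKb := isBounded_cube N 0 R
  set K := cube N 0 R
  obtain ⟨M, hM⟩ := hsol.bounded
  have hz0 := hζ.indicator_nonneg
  have hz1 := hζ.indicator_le_one
  obtain ⟨L, hzL⟩ := hζ.exists_lipschitzWith_indicator hK
  have hfc : ContinuousOn (logEnergy g k δ) (Ici 0) := fun v hv =>
    (hg.hasDerivAt_logEnergy h0 hk (add_pos_of_nonneg_of_pos hv
      (mul_pos hδ.1 hk))).continuousAt.continuousWithinAt
  have hm : ContinuousOn (fun t => ∫ x in K, logEnergy g k δ (u x t) * K.indicator ζ x ^ q)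
      (Icc t0 t1) :=
    continuousOn_integral_comp_mul hK hKb hsol.continuousOn hu0
      (fun x hx t ht => (le_abs_self _).trans (hM x hx t ht)) hfc
      (hzL.continuous.rpow_const fun _ => Or.inr hq0.le) fun x => by
        rw [abs_of_nonneg (Real.rpow_nonneg (hz0 x) _)]
        exact Real.rpow_le_one (hz0 x) (hz1 x) hq0.le
  have hend : ∀ t ∈ Icc t0 t1, ∫ x in K, logEnergy g k δ (u x t) * K.indicator ζ x ^ q =
      ∫ x in K, bigH g (logPsi k δ (u x t) ^ 2) * ζ x ^ q := fun t htt =>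
    setIntegral_congr_fun hK.measurableSet fun x hx => by
      simp only [indicator_of_mem hx, logEnergy_eq g hk hδ.1 (hu0 x hx t htt)]
  have hmain := sub_le_of_forall_timeStep ht hm fun τ hτ hτT =>
    hsol.log_energy_timeStep hg h0 h1 hC0 hC1 hq hε0 (min_le_left _ _) hεC hk hδ.1 hK hKb hu0 hζ
      hτ hτT
  rw [hend t1 (right_mem_Icc.2 ht.le), hend t0 (left_mem_Icc.2 ht.le)] at hmain
  linarith
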